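/- arXiv:1905.10560 — 2 statements merged into one kernel-verified Lean document; each statement's English description precedes it below -/
import Mathlib

section
/- Let n ≥ 3 and let G_n = G_n(m₁, …, m_n) be the caterpillar graph consisting of a central path on n vertices with m_i ≥ 0 pendant edges attached to the i-th path vertex, where m₁ ≥ 1; set t_i = m_i − 1. For each caterpillar, its matching complex is homotopy equivalent to a wedge of spheres; let A_{n,d} denote the number of spheres of dimension d in the homotopy type of M(G_n(m₁, …, m_n)). Then the number A_{n+1,d} of d-spheres in M(G_{n+1}(m₁, …, m_n, m_{n+1})) satisfies: A_{n+1,d} = t_{n+1}·A_{n,d−1} + A_{n−1,d−1} if m_{n+1} ≥ 1; A_{n+1,d} = A_{n,d} + A_{n−1,d−1} if m_{n+1} = 0 and m_n ≥ 1; and A_{n+1,d} = A_{n−2,d−1} if m_{n+1} = m_n = 0, where A_{k,d} refers to the caterpillar on the first k path vertices with leg counts (m₁, …, m_k). -/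
open SimpleGraph

/-- Two edges (as elements of `Sym2 V`) are incident if they share a vertex. -/
def EdgeIncident {V : Type*} (e f : Sym2 V) : Prop := ∃ v, v ∈ e ∧ v ∈ f

/-- The matching complex of a graph, as the set of its faces:
finite sets of pairwise non-incident edges of `G`. -/
def matchingComplex {V : Type*} (G : SimpleGraph V) : Set (Finset (Sym2 V)) :=
  {m | (∀ e ∈ m, e ∈ G.edgeSet) ∧
    (m : Set (Sym2 V)).Pairwise fun e f => ¬ EdgeIncident e f}

/-- The geometric realization of an abstract simplicial complex, given as a
downward-closed set of finite subsets of the vertex type `α`. -/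
abbrev Realization {α : Type*} (K : Set (Finset α)) : Type _ :=
  { f : α → ℝ // (∀ a, 0 ≤ f a) ∧
      ∃ s ∈ K, (∀ a, f a ≠ 0 → a ∈ s) ∧ ∑ a ∈ s, f a = 1 }

/-- The `n`-dimensional sphere. -/
abbrev SphereD (n : ℕ) : Type :=
  Metric.sphere (0 : EuclideanSpace ℝ (Fin (n + 1))) 1

/-- A basepoint of the `n`-sphere. -/
noncomputable def SphereD.pt (n : ℕ) : SphereD n :=
  ⟨EuclideanSpace.single 0 1, by simp [EuclideanSpace.norm_single]⟩

/-- The relation collapsing all basepoints (and the extra point) of a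
family of pointed spaces to one point. -/
def WedgeRel {ι : Type*} (X : ι → Type*) (pt : ∀ i, X i) :
    ((Σ i, X i) ⊕ Unit) → ((Σ i, X i) ⊕ Unit) → Prop := fun p q =>
  (p = Sum.inr () ∨ ∃ i, p = Sum.inl ⟨i, pt i⟩) ∧
  (q = Sum.inr () ∨ ∃ i, q = Sum.inl ⟨i, pt i⟩)

/-- The wedge sum of a family of pointed spaces (with an extra basepoint, so that
the wedge of the empty family is a one-point space). -/
abbrev PWedge {ι : Type*} (X : ι → Type*) [∀ i, TopologicalSpace (X i)]
    (pt : ∀ i, X i) : Type _ :=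
  Quot (WedgeRel X pt)

/-- A wedge of spheres with prescribed dimensions `d i`. -/
noncomputable abbrev WedgeOfSpheres {ι : Type*} (d : ι → ℕ) : Type _ :=
  PWedge (fun i => SphereD (d i)) (fun i => SphereD.pt (d i))

/-- A wedge of spheres with `c d` spheres of dimension `d` for every `d : ℕ`. -/
noncomputable abbrev WedgeOfSpheresCounted (c : ℕ → ℕ) : Type _ :=
  WedgeOfSpheres (fun p : Σ d : ℕ, Fin (c d) => p.1)

/-- The caterpillar graph on a central path with `n` vertices, with `m i` pendant
edges (legs) attached to the `i`-th path vertex. -/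
def caterpillar (n : ℕ) (m : Fin n → ℕ) :
    SimpleGraph (Fin n ⊕ Σ i : Fin n, Fin (m i)) :=
  SimpleGraph.fromRel fun p q =>
    match p, q with
    | Sum.inl i, Sum.inl j => (i : ℕ) + 1 = (j : ℕ)
    | Sum.inl i, Sum.inr j => i = j.1
    | _, _ => False

/-- Cochains on `X` in all degrees at once, with coefficients in `ZMod 2`: the value on a list of
length `n` is the component of (reduced) degree `n - 1`. -/
abbrev Cochain (X : Type*) := List X → ZMod 2

namespace Cochain

variable {X Y : Type}

/-- The value of the coboundary of `f` on a list: the sum of `f` over all lists obtained by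
omitting one entry. -/
def coboundaryAux : List X → Cochain X → ZMod 2
  | [], _ => 0
  | x :: l, f => f l + coboundaryAux l (fun l' => f (x :: l'))

theorem coboundaryAux_add (l : List X) (f g : Cochain X) :
    coboundaryAux l (f + g) = coboundaryAux l f + coboundaryAux l g := by
  induction l generalizing f g with
  | nil => simp [coboundaryAux]
  | cons x l ih =>
    have := ih (fun l' => f (x :: l')) (fun l' => g (x :: l'))
    simp only [coboundaryAux, Pi.add_apply]
    rw [show (fun l' => f (x :: l') + g (x :: l')) =
      (fun l' => f (x :: l')) + (fun l' => g (x :: l')) from rfl, this]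
    ring

theorem coboundaryAux_smul (l : List X) (c : ZMod 2) (f : Cochain X) :
    coboundaryAux l (c • f) = c • coboundaryAux l f := by
  induction l generalizing f with
  | nil => simp [coboundaryAux]
  | cons x l ih =>
    have := ih (fun l' => f (x :: l'))
    simp only [coboundaryAux, Pi.smul_apply]
    rw [show (fun l' => c • f (x :: l')) = c • (fun l' => f (x :: l')) from rfl, this, smul_add]

/-- The Alexander–Spanier coboundary. -/
def coboundary : Cochain X →ₗ[ZMod 2] Cochain X where
  toFun f l := coboundaryAux l f
  map_add' f g := by ext l; exact coboundaryAux_add l f g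
  map_smul' c f := by ext l; exact coboundaryAux_smul l c f

local notation "δ" => coboundary

@[simp] theorem coboundary_nil (f : Cochain X) : δ f [] = 0 := rfl

theorem coboundary_cons (f : Cochain X) (x : X) (l : List X) :
    δ f (x :: l) = f l + δ (fun l' => f (x :: l')) l := rfl

theorem coboundary_coboundary (f : Cochain X) : δ (δ f) = 0 := by
  ext l
  induction l generalizing f with
  | nil => rfl
  | cons x l ih =>
    rw [coboundary_cons]
    have h : (fun l' => δ f (x :: l')) = f + δ (fun l' => f (x :: l')) := by
      ext l'; rfl
    rw [h, map_add, Pi.add_apply, ih, ← add_assoc, CharTwo.add_self_eq_zero]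
    rfl

theorem coboundary_congr {f g : Cochain X} {l : List X}
    (h : ∀ l', l' ⊆ l → l'.length + 1 = l.length → f l' = g l') : δ f l = δ g l := by
  induction l generalizing f g with
  | nil => rfl
  | cons x l ih =>
    rw [coboundary_cons, coboundary_cons, h l (List.subset_cons_self x l) rfl]
    congr 1
    refine ih fun l' hl' hlen => h _ (List.cons_subset_cons x hl') (by simpa using hlen)

theorem coboundary_eq_zero {f : Cochain X} {l : List X}
    (h : ∀ l', l' ⊆ l → l'.length + 1 = l.length → f l' = 0) : δ f l = 0 := by
  rw [coboundary_congr (g := 0) h, map_zero]; rfl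

theorem coboundary_length (a : ℕ → ZMod 2) (l : List X) :
    δ (fun l' => a l'.length) l = l.length * a (l.length - 1) := by
  induction l generalizing a with
  | nil => simp
  | cons x l ih =>
    rw [coboundary_cons]
    have := ih fun n => a (n + 1)
    simp only [List.length_cons] at this ⊢
    rw [this]
    rcases Nat.eq_zero_or_pos l.length with h | h
    · simp [h]
    · rw [Nat.sub_add_cancel h]; push_cast; ring

/-- Pullback of cochains along an arbitrary function. -/
def pull (φ : X → Y) : Cochain Y →ₗ[ZMod 2] Cochain X where
  toFun f l := f (l.map φ)
  map_add' _ _ := rfl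
  map_smul' _ _ := rfl

@[simp] theorem pull_apply (φ : X → Y) (f : Cochain Y) (l : List X) :
    pull φ f l = f (l.map φ) := rfl

theorem pull_id (f : Cochain X) : pull id f = f := by
  ext l
  simp

theorem pull_pull {Z : Type} (φ : X → Y) (ψ : Y → Z) (f : Cochain Z) :
    pull φ (pull ψ f) = pull (fun x => ψ (φ x)) f := by
  ext l
  simp [Function.comp_def]

theorem coboundary_pull (φ : X → Y) (f : Cochain Y) : δ (pull φ f) = pull φ (δ f) := by
  ext l
  induction l generalizing f with
  | nil => rfl
  | cons x l ih =>
    rw [coboundary_cons, pull_apply, pull_apply, List.map_cons, coboundary_cons,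
      ← pull_apply φ (δ _), ← ih]
    rfl

/-- Restriction of a cochain to a single degree. -/
def trunc (n : ℕ) : Cochain X →ₗ[ZMod 2] Cochain X where
  toFun f l := if l.length = n then f l else 0
  map_add' f g := by ext l; by_cases h : l.length = n <;> simp [h]
  map_smul' c f := by ext l; by_cases h : l.length = n <;> simp [h]

theorem trunc_apply (n : ℕ) (f : Cochain X) (l : List X) :
    trunc n f l = if l.length = n then f l else 0 := rfl

theorem trunc_trunc (n : ℕ) (f : Cochain X) : trunc n (trunc n f) = trunc n f := by
  ext l; simp only [trunc_apply]; split_ifs <;> rfl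

theorem coboundary_trunc (n : ℕ) (f : Cochain X) : δ (trunc n f) = trunc (n + 1) (δ f) := by
  ext l
  rw [trunc_apply]
  split_ifs with h
  · exact coboundary_congr fun l' _ hl => by rw [trunc_apply, if_pos (by omega)]
  · exact coboundary_eq_zero fun l' _ hl => by rw [trunc_apply, if_neg (by omega)]

theorem pull_trunc (n : ℕ) (φ : X → Y) (f : Cochain Y) :
    pull φ (trunc n f) = trunc n (pull φ f) := by
  ext l; simp [trunc_apply]

open Classical in
/-- Replacing a cochain by zero on the lists that are not contained in `C`. -/
noncomputable def cut (C : Set X) : Cochain X →ₗ[ZMod 2] Cochain X where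
  toFun f l := if ∀ x ∈ l, x ∈ C then f l else 0
  map_add' f g := by ext l; simp only [Pi.add_apply]; split_ifs <;> simp
  map_smul' c f := by ext l; simp

theorem cut_of_mem {C : Set X} (f : Cochain X) {l : List X} (h : ∀ x ∈ l, x ∈ C) :
    cut C f l = f l := if_pos h

theorem cut_of_notMem {C : Set X} (f : Cochain X) {l : List X} (h : ¬ ∀ x ∈ l, x ∈ C) :
    cut C f l = 0 := if_neg h

theorem cut_trunc (n : ℕ) (C : Set X) (f : Cochain X) :
    cut C (trunc n f) = trunc n (cut C f) := by
  ext l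
  by_cases h : ∀ x ∈ l, x ∈ C
  · rw [cut_of_mem _ h, trunc_apply, trunc_apply, cut_of_mem _ h]
  · rw [cut_of_notMem _ h, trunc_apply, cut_of_notMem _ h, ite_self]

/-- The connecting homomorphism of the Mayer–Vietoris sequence of `A` and `B`, on cochains. -/
noncomputable def connecting (A B : Set X) : Cochain X →ₗ[ZMod 2] Cochain X :=
  cut A ∘ₗ δ ∘ₗ cut (A ∩ B)

theorem connecting_trunc {A B : Set X} (n : ℕ) (u : Cochain X) :
    connecting A B (trunc n u) = trunc (n + 1) (connecting A B u) := by
  simp only [connecting, LinearMap.comp_apply, cut_trunc, coboundary_trunc]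

/-- The prism operator between two functions. -/
def prismAux (a b : X → Y) : List X → Cochain Y → ZMod 2
  | [], _ => 0
  | x :: l, f => f (a x :: b x :: l.map b) + prismAux a b l (fun l' => f (a x :: l'))

theorem prismAux_add (a b : X → Y) (l : List X) (f g : Cochain Y) :
    prismAux a b l (f + g) = prismAux a b l f + prismAux a b l g := by
  induction l generalizing f g with
  | nil => simp [prismAux]
  | cons x l ih =>
    have := ih (fun l' => f (a x :: l')) (fun l' => g (a x :: l'))
    simp only [prismAux, Pi.add_apply]
    rw [show (fun l' => f (a x :: l') + g (a x :: l')) =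
      (fun l' => f (a x :: l')) + (fun l' => g (a x :: l')) from rfl, this]
    ring

/-- The prism operator as a map on cochains. -/
def prism (a b : X → Y) (f : Cochain Y) : Cochain X := fun l => prismAux a b l f

theorem prism_add (a b : X → Y) (f g : Cochain Y) :
    prism a b (f + g) = prism a b f + prism a b g := by
  ext l; exact prismAux_add a b l f g

theorem prism_cons (a b : X → Y) (f : Cochain Y) (x : X) (l : List X) :
    prism a b f (x :: l) =
      f (a x :: b x :: l.map b) + prism a b (fun l' => f (a x :: l')) l := rfl

theorem prism_eq_zero {a b : X → Y} {f : Cochain Y} {U : Set Y} {l : List X}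
    (hf : ∀ l' : List Y, l' ≠ [] → (∀ y ∈ l', y ∈ U) → f l' = 0)
    (hl : ∀ x ∈ l, a x ∈ U ∧ b x ∈ U) : prism a b f l = 0 := by
  induction l generalizing f with
  | nil => rfl
  | cons x l ih =>
    rw [prism_cons, hf _ (List.cons_ne_nil _ _), zero_add]
    · refine ih (fun l' _ hl' => hf _ (List.cons_ne_nil _ _) ?_)
        fun y hy => hl y (List.mem_cons_of_mem _ hy)
      simp only [List.mem_cons, forall_eq_or_imp]
      exact ⟨(hl x List.mem_cons_self).1, hl'⟩
    · simp only [List.mem_cons, forall_eq_or_imp, List.mem_map, forall_exists_index, and_imp,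
        forall_apply_eq_imp_iff₂]
      exact ⟨(hl x List.mem_cons_self).1, (hl x List.mem_cons_self).2,
        fun y hy => (hl y (List.mem_cons_of_mem _ hy)).2⟩

theorem coboundary_prism (a b : X → Y) (f : Cochain Y) :
    pull a f - pull b f - δ (prism a b f) = prism a b (δ f) := by
  ext l
  simp only [Pi.sub_apply, CharTwo.sub_eq_add]
  induction l generalizing f with
  | nil => simp [prism, prismAux, CharTwo.add_self_eq_zero]
  | cons x l ih =>
    have h1 : (fun l' => prism a b f (x :: l')) =
        pull b (fun l' => f (a x :: b x :: l')) + prism a b (fun l' => f (a x :: l')) := by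
      ext l'; rfl
    have h2 : (fun l' => δ f (a x :: l')) = f + δ (fun l' => f (a x :: l')) := by
      ext l'; rfl
    have h3 := ih (fun l' => f (a x :: l'))
    rw [prism_cons, coboundary_cons, coboundary_cons, coboundary_cons, h1, h2, map_add,
      coboundary_pull, prism_add]
    simp only [Pi.add_apply, List.map_cons, ← h3, pull_apply]
    linear_combination -(f (a x :: l.map b)) * CharTwo.two_eq_zero (R := ZMod 2)

section Topology

variable [TopologicalSpace X] [TopologicalSpace Y]

/-- Cochains on a subset `S` of a space are considered up to those that vanish near the diagonal
of `S`. -/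
def negligible (S : Set X) : Submodule (ZMod 2) (Cochain X) where
  carrier := {f | f [] = 0 ∧ ∀ x ∈ S, ∃ U ∈ nhds x, ∀ l : List X,
    (∀ y ∈ l, y ∈ S ∧ y ∈ U) → f l = 0}
  zero_mem' := ⟨rfl, fun _ _ => ⟨Set.univ, Filter.univ_mem, fun _ _ => rfl⟩⟩
  add_mem' := by
    rintro f g ⟨hf, hf'⟩ ⟨hg, hg'⟩
    refine ⟨by simp [hf, hg], fun x hx => ?_⟩
    obtain ⟨U, hU, hfU⟩ := hf' x hx
    obtain ⟨V, hV, hgV⟩ := hg' x hx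
    refine ⟨U ∩ V, Filter.inter_mem hU hV, fun l hl => ?_⟩
    rw [Pi.add_apply, hfU l fun y hy => ⟨(hl y hy).1, (hl y hy).2.1⟩,
      hgV l fun y hy => ⟨(hl y hy).1, (hl y hy).2.2⟩, add_zero]
  smul_mem' := by
    rintro c f ⟨hf, hf'⟩
    refine ⟨by simp [hf], fun x hx => ?_⟩
    obtain ⟨U, hU, hfU⟩ := hf' x hx
    exact ⟨U, hU, fun l hl => by rw [Pi.smul_apply, hfU l hl, smul_zero]⟩

theorem negligible_anti {S T : Set X} (h : S ⊆ T) : negligible T ≤ negligible S := by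
  rintro f ⟨hf, hf'⟩
  refine ⟨hf, fun x hx => ?_⟩
  obtain ⟨U, hU, hfU⟩ := hf' x (h hx)
  exact ⟨U, hU, fun l hl => hfU l fun y hy => ⟨h (hl y hy).1, (hl y hy).2⟩⟩

theorem negligible_congr {S : Set X} {f g : Cochain X}
    (h : ∀ l : List X, (∀ y ∈ l, y ∈ S) → f l = g l) (hg : g ∈ negligible S) :
    f ∈ negligible S := by
  refine ⟨by rw [h [] (by simp), hg.1], fun x hx => ?_⟩
  obtain ⟨U, hU, hgU⟩ := hg.2 x hx
  exact ⟨U, hU, fun l hl => by rw [h l fun y hy => (hl y hy).1, hgU l hl]⟩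

theorem negligible_of_eq_zero {S : Set X} {f : Cochain X}
    (h : ∀ l : List X, (∀ y ∈ l, y ∈ S) → f l = 0) : f ∈ negligible S :=
  negligible_congr (g := 0) h (zero_mem _)

theorem coboundary_mem_negligible {S : Set X} {f : Cochain X} (hf : f ∈ negligible S) :
    δ f ∈ negligible S := by
  refine ⟨rfl, fun x hx => ?_⟩
  obtain ⟨U, hU, hfU⟩ := hf.2 x hx
  exact ⟨U, hU, fun l hl => coboundary_eq_zero fun l' hl' _ => hfU l' fun y hy => hl y (hl' hy)⟩

theorem trunc_mem_negligible {S : Set X} {f : Cochain X} (n : ℕ) (hf : f ∈ negligible S) :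
    trunc n f ∈ negligible S := by
  refine ⟨by rw [trunc_apply, hf.1, ite_self], fun x hx => ?_⟩
  obtain ⟨U, hU, hfU⟩ := hf.2 x hx
  exact ⟨U, hU, fun l hl => by rw [trunc_apply, hfU l hl, ite_self]⟩

theorem pull_mem_negligible {S : Set X} {T : Set Y} {φ : X → Y} (hφ : ContinuousOn φ S)
    (hm : Set.MapsTo φ S T) {f : Cochain Y} (hf : f ∈ negligible T) : pull φ f ∈ negligible S := by
  refine ⟨hf.1, fun x hx => ?_⟩
  obtain ⟨U, hU, hfU⟩ := hf.2 (φ x) (hm hx)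
  obtain ⟨V, hV, hVU⟩ := mem_nhdsWithin_iff_exists_mem_nhds_inter.1 (hφ x hx hU)
  refine ⟨V, hV, fun l hl => hfU _ ?_⟩
  simp only [List.mem_map, forall_exists_index, and_imp, forall_apply_eq_imp_iff₂]
  exact fun y hy => ⟨hm (hl y hy).1, hVU ⟨(hl y hy).2, (hl y hy).1⟩⟩

theorem cut_mem_negligible {C : Set X} (hC : IsClosed C) {f : Cochain X}
    (hf : f ∈ negligible C) : cut C f ∈ negligible (Set.univ : Set X) := by
  refine ⟨by rw [cut_of_mem _ (by simp), hf.1], fun x _ => ?_⟩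
  by_cases hx : x ∈ C
  · obtain ⟨U, hU, hfU⟩ := hf.2 x hx
    refine ⟨U, hU, fun l hl => ?_⟩
    by_cases h : ∀ y ∈ l, y ∈ C
    · rw [cut_of_mem _ h, hfU l fun y hy => ⟨h y hy, (hl y hy).2⟩]
    · rw [cut_of_notMem _ h]
  · refine ⟨Cᶜ, hC.isOpen_compl.mem_nhds hx, fun l hl => ?_⟩
    cases l with
    | nil => rw [cut_of_mem _ (by simp), hf.1]
    | cons y l => exact cut_of_notMem _ fun h =>
        (hl y List.mem_cons_self).2 (h y List.mem_cons_self)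

theorem mem_negligible_union {A B : Set X} {f : Cochain X}
    (h : ∀ x ∈ A ∪ B, (∃ U ∈ nhds x, U ∩ (A ∪ B) ⊆ A) ∨ ∃ U ∈ nhds x, U ∩ (A ∪ B) ⊆ B)
    (hA : f ∈ negligible A) (hB : f ∈ negligible B) : f ∈ negligible (A ∪ B) := by
  refine ⟨hA.1, fun x hx => ?_⟩
  rcases h x hx with ⟨U, hU, hUA⟩ | ⟨U, hU, hUB⟩
  · obtain ⟨V, hV, hfV⟩ := hA.2 x (hUA ⟨mem_of_mem_nhds hU, hx⟩)
    exact ⟨U ∩ V, Filter.inter_mem hU hV, fun l hl => hfV l fun y hy =>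
      ⟨hUA ⟨(hl y hy).2.1, (hl y hy).1⟩, (hl y hy).2.2⟩⟩
  · obtain ⟨V, hV, hfV⟩ := hB.2 x (hUB ⟨mem_of_mem_nhds hU, hx⟩)
    exact ⟨U ∩ V, Filter.inter_mem hU hV, fun l hl => hfV l fun y hy =>
      ⟨hUB ⟨(hl y hy).2.1, (hl y hy).1⟩, (hl y hy).2.2⟩⟩

theorem exists_glue {A B : Set X} (hA : IsClosed A) (hB : IsClosed B) {f g : Cochain X}
    (h : f - g ∈ negligible (A ∩ B)) :
    ∃ k, k - f ∈ negligible A ∧ k - g ∈ negligible B := by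
  classical
  refine ⟨fun l => if ∀ x ∈ l, x ∈ B then g l else f l, ?_, ?_⟩
  · have h1 := negligible_anti (Set.subset_univ A) (cut_mem_negligible (hA.inter hB) h)
    refine negligible_congr (fun l hl => ?_) (neg_mem h1)
    by_cases hlB : ∀ y ∈ l, y ∈ B
    · rw [Pi.neg_apply, cut_of_mem (C := A ∩ B) _ fun y hy => ⟨hl y hy, hlB y hy⟩]
      simp only [Pi.sub_apply, if_pos hlB]; ring
    · rw [Pi.neg_apply, cut_of_notMem _ fun h => hlB fun y hy => (h y hy).2]
      simp only [Pi.sub_apply, if_neg hlB]; ring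
  · refine negligible_of_eq_zero fun l hl => ?_
    simp only [Pi.sub_apply, if_pos hl, sub_self]

/-- The cocycles of a given degree on `S`. -/
def cocycles (n : ℕ) (S : Set X) : Submodule (ZMod 2) (Cochain X) :=
  LinearMap.eqLocus (trunc n) LinearMap.id ⊓ (negligible S).comap δ

/-- The cochains that are coboundaries on `S`. -/
def coboundaries (S : Set X) : Submodule (ZMod 2) (Cochain X) :=
  LinearMap.range δ ⊔ negligible S

theorem mem_cocycles {n : ℕ} {S : Set X} {f : Cochain X} :
    f ∈ cocycles n S ↔ trunc n f = f ∧ δ f ∈ negligible S := Iff.rfl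

theorem mem_coboundaries {S : Set X} {f : Cochain X} :
    f ∈ coboundaries S ↔ ∃ g, f - δ g ∈ negligible S := by
  rw [coboundaries, Submodule.mem_sup]
  constructor
  · rintro ⟨_, ⟨g, rfl⟩, z, hz, rfl⟩
    exact ⟨g, by simpa using hz⟩
  · rintro ⟨g, hg⟩
    exact ⟨δ g, ⟨g, rfl⟩, f - δ g, hg, by abel⟩

theorem coboundary_mem_coboundaries {S : Set X} (f : Cochain X) : δ f ∈ coboundaries S :=
  Submodule.mem_sup_left (LinearMap.mem_range_self _ f)

theorem negligible_le_coboundaries (S : Set X) : negligible S ≤ coboundaries S := le_sup_right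

theorem coboundaries_anti {S T : Set X} (h : S ⊆ T) : coboundaries T ≤ coboundaries S :=
  sup_le_sup_left (negligible_anti h) _

theorem trunc_mem_coboundaries {S : Set X} {f : Cochain X} (n : ℕ) (hf : f ∈ coboundaries S) :
    trunc n f ∈ coboundaries S := by
  obtain ⟨g, hg⟩ := mem_coboundaries.1 hf
  have h := trunc_mem_negligible n hg
  rw [map_sub] at h
  cases n with
  | zero =>
    have h0 : trunc 0 (δ g) = 0 := by
      ext l
      rw [trunc_apply]
      split_ifs with hl
      · rw [List.length_eq_zero_iff.1 hl]; rfl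
      · rfl
    rw [h0, sub_zero] at h
    exact negligible_le_coboundaries S h
  | succ n =>
    rw [← coboundary_trunc] at h
    exact mem_coboundaries.2 ⟨_, h⟩

theorem trunc_mem_cocycles {S : Set X} {f : Cochain X} (n : ℕ) (hf : δ f ∈ negligible S) :
    trunc n f ∈ cocycles n S :=
  mem_cocycles.2 ⟨trunc_trunc n f, by
    rw [coboundary_trunc]; exact trunc_mem_negligible _ hf⟩

theorem pull_mem_coboundaries {S : Set X} {T : Set Y} {φ : X → Y} (hφ : ContinuousOn φ S)
    (hm : Set.MapsTo φ S T) {f : Cochain Y} (hf : f ∈ coboundaries T) :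
    pull φ f ∈ coboundaries S := by
  obtain ⟨g, hg⟩ := mem_coboundaries.1 hf
  refine mem_coboundaries.2 ⟨pull φ g, ?_⟩
  rw [coboundary_pull, ← map_sub]
  exact pull_mem_negligible hφ hm hg

theorem coboundary_pull_mem {S : Set X} {T : Set Y} {φ : X → Y} (hφ : ContinuousOn φ S)
    (hm : Set.MapsTo φ S T) {f : Cochain Y} (hf : δ f ∈ negligible T) :
    δ (pull φ f) ∈ negligible S := by
  rw [coboundary_pull]
  exact pull_mem_negligible hφ hm hf

theorem pull_mem_cocycles {n : ℕ} {S : Set X} {T : Set Y} {φ : X → Y} (hφ : ContinuousOn φ S)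
    (hm : Set.MapsTo φ S T) {f : Cochain Y} (hf : f ∈ cocycles n T) :
    pull φ f ∈ cocycles n S :=
  mem_cocycles.2 ⟨by rw [← pull_trunc, (mem_cocycles.1 hf).1],
    coboundary_pull_mem hφ hm hf.2⟩

/-- The reduced cohomology of `S` in degree `n - 1`. -/
abbrev Cohomology (n : ℕ) (S : Set X) : Type :=
  cocycles n S ⧸ (coboundaries S).submoduleOf (cocycles n S)

/-- The dimension of the reduced cohomology of `S` in degree `n - 1`. -/
noncomputable def betti (n : ℕ) (S : Set X) : Cardinal :=
  Module.rank (ZMod 2) (Cohomology n S)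

theorem betti_eq_zero {n : ℕ} {S : Set X} (h : ∀ f, δ f ∈ negligible S → f ∈ coboundaries S) :
    betti n S = 0 := by
  have : Subsingleton (Cohomology n S) := by
    rw [Submodule.Quotient.subsingleton_iff, Submodule.submoduleOf_eq_top]
    exact fun f hf => h f hf.2
  exact rank_subsingleton' _ _

theorem cocycles_zero_le {S : Set X} (hS : S.Nonempty) : cocycles 0 S ≤ coboundaries S := by
  refine fun f hf => negligible_le_coboundaries S ?_
  obtain ⟨x, hx⟩ := hS
  obtain ⟨U, hU, hfU⟩ := hf.2.2 x hx
  have h0 : f [] = 0 := by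
    have h1 := hfU [x] (by simpa using ⟨hx, mem_of_mem_nhds hU⟩)
    have h2 : δ f [x] = f [] := by simp [coboundary_cons]
    rw [← h2, h1]
  refine negligible_of_eq_zero fun l _ => ?_
  rw [← (mem_cocycles.1 hf).1, trunc_apply]
  split_ifs with h
  · rw [List.length_eq_zero_iff.1 h, h0]
  · rfl

theorem betti_zero_eq_zero {S : Set X} (hS : S.Nonempty) : betti 0 S = 0 := by
  have : Subsingleton (Cohomology 0 S) := by
    rw [Submodule.Quotient.subsingleton_iff, Submodule.submoduleOf_eq_top]
    exact cocycles_zero_le hS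
  exact rank_subsingleton' _ _

theorem betti_empty (n : ℕ) : betti n (∅ : Set X) = if n = 0 then 1 else 0 := by
  split_ifs with h
  · subst h
    have hker : ∀ f ∈ cocycles 0 (∅ : Set X), f ∈ coboundaries (∅ : Set X) ↔ f [] = 0 := by
      refine fun f _ => ⟨fun hf => ?_, fun hf => ?_⟩
      · obtain ⟨g, hg⟩ := mem_coboundaries.1 hf
        simpa using hg.1
      · exact negligible_le_coboundaries _ ⟨hf, by simp⟩
    let ev : cocycles 0 (∅ : Set X) →ₗ[ZMod 2] ZMod 2 :=
      (LinearMap.proj ([] : List X)).comp (Submodule.subtype _)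
    have hev : LinearMap.ker ev = (coboundaries (∅ : Set X)).submoduleOf (cocycles 0 ∅) := by
      ext f
      rw [LinearMap.mem_ker]
      exact (hker f f.2).symm
    have hsurj : Function.Surjective ev := by
      intro c
      refine ⟨⟨trunc 0 fun _ => c, trunc_mem_cocycles 0 ⟨rfl, by simp⟩⟩, ?_⟩
      simp [ev, trunc_apply]
    have e := LinearMap.quotKerEquivOfSurjective ev hsurj
    rw [hev] at e
    rw [betti, e.rank_eq, Module.rank_self]
  · have : Subsingleton (Cohomology n (∅ : Set X)) := by
      rw [Submodule.Quotient.subsingleton_iff, Submodule.submoduleOf_eq_top]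
      refine fun f hf => negligible_le_coboundaries _ ⟨?_, by simp⟩
      rw [← (mem_cocycles.1 hf).1, trunc_apply, if_neg (by simpa using Ne.symm h)]
    exact rank_subsingleton' _ _

/-- The map on cohomology induced by a linear map of cochains. -/
noncomputable def cohomologyMap {n m : ℕ} {S : Set X} {T : Set Y}
    (F : Cochain X →ₗ[ZMod 2] Cochain Y) (hZ : ∀ f ∈ cocycles n S, F f ∈ cocycles m T)
    (hB : ∀ f ∈ cocycles n S, f ∈ coboundaries S → F f ∈ coboundaries T) :
    Cohomology n S →ₗ[ZMod 2] Cohomology m T :=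
  Submodule.mapQ _ _ (F.restrict hZ) fun f hf => hB f f.2 hf

theorem mk_eq_zero_iff {n : ℕ} {S : Set X} (f : cocycles n S) :
    (Submodule.Quotient.mk f : Cohomology n S) = 0 ↔ (f : Cochain X) ∈ coboundaries S :=
  Submodule.Quotient.mk_eq_zero _

theorem betti_eq_add {Z : Type} [TopologicalSpace Z] {n m k : ℕ} {S : Set X} {T : Set Y} {R : Set Z}
    (F : Cochain X →ₗ[ZMod 2] Cochain Y) (G : Cochain Y →ₗ[ZMod 2] Cochain Z)
    (hFZ : ∀ f ∈ cocycles n S, F f ∈ cocycles m T)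
    (hFB : ∀ f ∈ cocycles n S, f ∈ coboundaries S → F f ∈ coboundaries T)
    (hGZ : ∀ f ∈ cocycles m T, G f ∈ cocycles k R)
    (hGB : ∀ f ∈ cocycles m T, f ∈ coboundaries T → G f ∈ coboundaries R)
    (hF : ∀ f ∈ cocycles n S, F f ∈ coboundaries T → f ∈ coboundaries S)
    (hGF : ∀ f ∈ cocycles n S, G (F f) ∈ coboundaries R)
    (hFG : ∀ f ∈ cocycles m T, G f ∈ coboundaries R →
      ∃ g ∈ cocycles n S, f - F g ∈ coboundaries T)
    (hG : ∀ f ∈ cocycles k R, ∃ g ∈ cocycles m T, f - G g ∈ coboundaries R) :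
    betti m T = betti n S + betti k R := by
  let F' := cohomologyMap F hFZ hFB
  let G' := cohomologyMap G hGZ hGB
  have hinj : Function.Injective F' := by
    rw [← LinearMap.ker_eq_bot, LinearMap.ker_eq_bot']
    intro a ha
    obtain ⟨f, rfl⟩ := Submodule.Quotient.mk_surjective _ a
    exact (mk_eq_zero_iff f).2 (hF f f.2 ((mk_eq_zero_iff _).1 ha))
  have hsurj : Function.Surjective G' := by
    intro a
    obtain ⟨f, rfl⟩ := Submodule.Quotient.mk_surjective _ a
    obtain ⟨g, hg, hfg⟩ := hG f f.2
    refine ⟨Submodule.Quotient.mk ⟨g, hg⟩, Eq.symm ?_⟩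
    exact (Submodule.Quotient.eq _).2 hfg
  have hex : LinearMap.ker G' = LinearMap.range F' := by
    ext a
    constructor
    · intro ha
      obtain ⟨f, rfl⟩ := Submodule.Quotient.mk_surjective _ a
      obtain ⟨g, hg, hfg⟩ := hFG f f.2 ((mk_eq_zero_iff _).1 ha)
      refine ⟨Submodule.Quotient.mk ⟨g, hg⟩, Eq.symm ?_⟩
      exact (Submodule.Quotient.eq _).2 hfg
    · rintro ⟨b, rfl⟩
      obtain ⟨f, rfl⟩ := Submodule.Quotient.mk_surjective _ b
      exact (mk_eq_zero_iff _).2 (hGF f f.2)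
  have h1 := LinearMap.rank_range_add_rank_ker G'
  rw [hex, rank_range_of_surjective _ hsurj] at h1
  rw [betti, ← h1, add_comm, ← (LinearEquiv.ofInjective F' hinj).rank_eq]
  rfl

/-- Two functions are cohomologous on `S` if they pull back cocycles on `T` to cocycles on `S` with
the same class. -/
def Cohomologous (S : Set X) (T : Set Y) (φ ψ : X → Y) : Prop :=
  ∀ f, δ f ∈ negligible T → pull φ f - pull ψ f ∈ coboundaries S

theorem Cohomologous.trans {S : Set X} {T : Set Y} {φ ψ χ : X → Y} (h₁ : Cohomologous S T φ ψ)
    (h₂ : Cohomologous S T ψ χ) : Cohomologous S T φ χ := fun f hf => by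
  simpa using add_mem (h₁ f hf) (h₂ f hf)

theorem Cohomologous.symm {S : Set X} {T : Set Y} {φ ψ : X → Y} (h : Cohomologous S T φ ψ) :
    Cohomologous S T ψ φ := fun f hf => by
  simpa using neg_mem (h f hf)

theorem Cohomologous.of_eqOn {S : Set X} {T : Set Y} {φ ψ : X → Y} (h : Set.EqOn φ ψ S) :
    Cohomologous S T φ ψ := fun f _ => by
  refine negligible_le_coboundaries _ (negligible_of_eq_zero fun l hl => ?_)
  rw [Pi.sub_apply, pull_apply, pull_apply, List.map_congr_left fun x hx => h (hl x hx), sub_self]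

theorem betti_eq_of_cohomologous {S : Set X} {T : Set Y} {φ : X → Y} {ψ : Y → X}
    (hφ : ContinuousOn φ S) (hφm : Set.MapsTo φ S T) (hψ : ContinuousOn ψ T)
    (hψm : Set.MapsTo ψ T S) (h₁ : Cohomologous S S (ψ ∘ φ) id)
    (h₂ : Cohomologous T T (φ ∘ ψ) id) (n : ℕ) : betti n S = betti n T := by
  have := betti_eq_add (n := n) (m := n) (k := 0) (S := T) (T := S) (R := ({0} : Set ℝ))
    (pull φ) 0 (fun f hf => pull_mem_cocycles hφ hφm hf)
    (fun f _ hf => pull_mem_coboundaries hφ hφm hf) (fun f _ => zero_mem _)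
    (fun f _ _ => zero_mem _) (fun f hf h => ?_) (fun f _ => zero_mem _) (fun f hf _ => ?_)
    (fun f hf => ⟨0, zero_mem _, ?_⟩)
  · rwa [betti_zero_eq_zero (Set.singleton_nonempty 0), add_zero] at this
  · have := sub_mem (pull_mem_coboundaries hψ hψm h) (h₂ f hf.2)
    have h3 : pull (φ ∘ ψ) f = pull ψ (pull φ f) := by ext l; simp
    have h4 : pull id f = f := by ext l; simp
    simpa [h3, h4] using this
  · refine ⟨pull ψ f, pull_mem_cocycles hψ hψm hf, ?_⟩
    have := neg_mem (h₁ f hf.2)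
    have h3 : pull (ψ ∘ φ) f = pull φ (pull ψ f) := by ext l; simp
    have h4 : pull id f = f := by ext l; simp
    simpa [h3, h4] using this
  · rw [map_zero, sub_zero]
    exact cocycles_zero_le (Set.singleton_nonempty 0) hf

theorem connecting_sub_mem {A B : Set X} (u : Cochain X) :
    connecting A B u - δ (cut (A ∩ B) u) ∈ negligible A :=
  negligible_of_eq_zero fun l hl => by
    rw [Pi.sub_apply, connecting, LinearMap.comp_apply, cut_of_mem _ hl]; exact sub_self _

theorem connecting_mem {A B : Set X} (hA : IsClosed A) (hB : IsClosed B) {u : Cochain X}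
    (hu : δ u ∈ negligible (A ∩ B)) : connecting A B u ∈ negligible B := by
  refine negligible_congr (fun l hl => ?_)
    (negligible_anti (Set.subset_univ B) (cut_mem_negligible (hA.inter hB) hu))
  by_cases h : ∀ y ∈ l, y ∈ A
  · have h' : ∀ y ∈ l, y ∈ A ∩ B := fun y hy => ⟨h y hy, hl y hy⟩
    rw [connecting, LinearMap.comp_apply, cut_of_mem _ h, cut_of_mem _ h']
    exact coboundary_congr fun l' hl' _ => cut_of_mem _ fun y hy => h' y (hl' hy)
  · rw [connecting, LinearMap.comp_apply, cut_of_notMem _ h,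
      cut_of_notMem _ fun h' => h fun y hy => (h' y hy).1]

theorem cut_sub_mem {C : Set X} (u : Cochain X) : cut C u - u ∈ negligible C :=
  negligible_of_eq_zero fun l hl => by rw [Pi.sub_apply, cut_of_mem _ hl, sub_self]

/-- The Mayer–Vietoris sequence when `A` is acyclic and the restriction from `B` to `A ∩ B` is
zero on cohomology. -/
theorem betti_union {A B : Set X} (hA : IsClosed A) (hB : IsClosed B)
    (hcov : ∀ x ∈ A ∪ B, (∃ U ∈ nhds x, U ∩ (A ∪ B) ⊆ A) ∨ ∃ U ∈ nhds x, U ∩ (A ∪ B) ⊆ B)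
    (hac : ∀ f, δ f ∈ negligible A → f ∈ coboundaries A)
    (hres : ∀ f, δ f ∈ negligible B → f ∈ coboundaries (A ∩ B)) (n : ℕ) :
    betti (n + 1) (A ∪ B) = betti n (A ∩ B) + betti (n + 1) B := by
  have hAU : A ⊆ A ∪ B := Set.subset_union_left
  have hBU : B ⊆ A ∪ B := Set.subset_union_right
  have hIA : A ∩ B ⊆ A := Set.inter_subset_left
  have hIB : A ∩ B ⊆ B := Set.inter_subset_right
  have union {f : Cochain X} := mem_negligible_union (f := f) hcov
  refine betti_eq_add (connecting A B) LinearMap.id ?_ ?_ ?_ ?_ ?_ ?_ ?_ ?_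
  · intro u hu
    rw [← (mem_cocycles.1 hu).1, connecting_trunc]
    refine trunc_mem_cocycles _ (union ?_ (coboundary_mem_negligible (connecting_mem hA hB hu.2)))
    simpa [coboundary_coboundary] using
      coboundary_mem_negligible (connecting_sub_mem (A := A) (B := B) u)
  · intro u hu hub
    obtain ⟨w, hw⟩ := mem_coboundaries.1 hub
    have hd : cut (A ∩ B) u - δ w - 0 ∈ negligible (A ∩ B) := by
      simpa using add_mem (cut_sub_mem (C := A ∩ B) u) hw
    obtain ⟨r, hrA, hrB⟩ := exists_glue hA hB hd
    refine mem_coboundaries.2 ⟨r, union ?_ ?_⟩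
    · have h1 := coboundary_mem_negligible hrA
      simp only [map_sub, coboundary_coboundary, sub_zero] at h1
      simpa using sub_mem (connecting_sub_mem (A := A) (B := B) u) h1
    · rw [sub_zero] at hrB
      exact sub_mem (connecting_mem hA hB hu.2) (coboundary_mem_negligible hrB)
  · exact fun f hf => mem_cocycles.2 ⟨(mem_cocycles.1 hf).1, negligible_anti hBU hf.2⟩
  · exact fun f _ hf => coboundaries_anti hBU hf
  · intro u hu huc
    obtain ⟨h, hh⟩ := mem_coboundaries.1 huc
    have h1 : cut (A ∩ B) u - h ∈ coboundaries A := by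
      refine hac _ ?_
      have := sub_mem (negligible_anti hAU hh) (connecting_sub_mem (A := A) (B := B) u)
      simpa using this
    have h2 : h ∈ coboundaries (A ∩ B) := by
      refine hres _ ?_
      simpa using sub_mem (connecting_mem hA hB hu.2) (negligible_anti hBU hh)
    have h3 := add_mem (coboundaries_anti hIA h1) h2
    simpa using sub_mem h3 (negligible_le_coboundaries _ (cut_sub_mem (C := A ∩ B) u))
  · exact fun u hu => negligible_le_coboundaries _ (connecting_mem hA hB hu.2)
  · intro h hh hhB
    obtain ⟨w, hw⟩ := mem_coboundaries.1 hhB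
    obtain ⟨v, hv⟩ := mem_coboundaries.1 (hac h (negligible_anti hAU hh.2))
    have hu : δ (v - w) ∈ negligible (A ∩ B) := by
      simpa using sub_mem (negligible_anti hIB hw) (negligible_anti hIA hv)
    refine ⟨trunc n (v - w), trunc_mem_cocycles _ hu, ?_⟩
    rw [connecting_trunc, ← (mem_cocycles.1 hh).1, ← map_sub]
    refine trunc_mem_coboundaries _ ?_
    have hd : v - cut (A ∩ B) (v - w) - w ∈ negligible (A ∩ B) := by
      have := neg_mem (cut_sub_mem (C := A ∩ B) (v - w))
      convert this using 1
      abel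
    obtain ⟨y, hyA, hyB⟩ := exists_glue hA hB hd
    refine mem_coboundaries.2 ⟨y, union ?_ ?_⟩
    · have h1 := coboundary_mem_negligible hyA
      have h2 := connecting_sub_mem (A := A) (B := B) (v - w)
      have := sub_mem (sub_mem hv h2) h1
      convert this using 1
      simp only [map_sub]
      abel
    · have h1 := coboundary_mem_negligible hyB
      have := sub_mem (sub_mem hw (connecting_mem hA hB hu)) h1
      convert this using 1
      simp only [map_sub, LinearMap.id_apply]
      abel
  · intro g hg
    obtain ⟨w, hw⟩ := mem_coboundaries.1 (hres g hg.2)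
    obtain ⟨k, hkA, hkB⟩ := exists_glue hA hB (f := δ w) (g := g) (by simpa using neg_mem hw)
    refine ⟨trunc (n + 1) k, trunc_mem_cocycles _ (union ?_ ?_), ?_⟩
    · simpa [coboundary_coboundary] using coboundary_mem_negligible hkA
    · simpa using add_mem (coboundary_mem_negligible hkB) hg.2
    · rw [LinearMap.id_apply, ← (mem_cocycles.1 hg).1, ← map_sub]
      refine negligible_le_coboundaries _ (trunc_mem_negligible _ ?_)
      simpa using neg_mem hkB

theorem pull_const_mem {S : Set X} {T : Set Y} {c : Y} (hc : c ∈ T) {f : Cochain Y}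
    (hf : δ f ∈ negligible T) : pull (fun _ => c) f ∈ coboundaries S := by
  let a : ℕ → ZMod 2 := fun n => f (List.replicate n c)
  have pull_pull : pull (fun _ : Y => c) f = fun l => a l.length := by
    ext l; simp [a]
  have ha (n : ℕ) : ((n + 1 : ℕ) : ZMod 2) * a n = 0 := by
    have h1 := coboundary_pull (fun _ : Y => c) f
    obtain ⟨U, hU, hfU⟩ := hf.2 c hc
    have h2 := congrFun h1 (List.replicate (n + 1) c)
    rw [pull_pull, coboundary_length, pull_apply, hfU, List.length_replicate] at h2
    · exact h2
    · simp only [List.mem_map, forall_exists_index, and_imp]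
      rintro y _ _ rfl
      exact ⟨hc, mem_of_mem_nhds hU⟩
  refine mem_coboundaries.2 ⟨fun l => a (l.length + 1), ?_⟩
  refine negligible_of_eq_zero fun l _ => ?_
  rw [Pi.sub_apply, pull_apply, coboundary_length (fun n => a (n + 1))]
  have h0 : f (l.map fun _ => c) = a l.length := by simp [a]
  have h1 := ha l.length
  rw [h0]
  push_cast at h1
  rcases Nat.eq_zero_or_pos l.length with h | h
  · simpa [h] using h1
  · rw [Nat.sub_add_cancel h]
    linear_combination h1 - l.length * a l.length * CharTwo.two_eq_zero (R := ZMod 2)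

theorem Cohomologous.mem_coboundaries_of_const {S : Set X} {T : Set Y} {φ : X → Y} {c : Y}
    (hc : c ∈ T) (h : Cohomologous S T φ fun _ => c) {f : Cochain Y} (hf : δ f ∈ negligible T) :
    pull φ f ∈ coboundaries S := by
  simpa using add_mem (h f hf) (pull_const_mem hc hf)

end Topology

theorem cohomologous_of_close [TopologicalSpace X] {S : Set X} {T : Set Y} {φ ψ : X → Y}
    {f : Cochain Y} (hφ : Set.MapsTo φ S T) (hψ : Set.MapsTo ψ S T)
    (h : ∀ x ∈ S, ∃ U : Set Y, (∀ l : List Y, (∀ y ∈ l, y ∈ T ∧ y ∈ U) → δ f l = 0) ∧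
      ∃ V ∈ nhds x, ∀ y ∈ S ∩ V, φ y ∈ U ∧ ψ y ∈ U) :
    pull φ f - pull ψ f ∈ coboundaries S := by
  refine mem_coboundaries.2 ⟨prism φ ψ f, ?_⟩
  rw [coboundary_prism]
  refine ⟨rfl, fun x hx => ?_⟩
  obtain ⟨U, hfU, V, hV, hVU⟩ := h x hx
  refine ⟨V, hV, fun l hl => prism_eq_zero (U := T ∩ U) (fun l' _ hl' => hfU l' hl') fun y hy => ?_⟩
  exact ⟨⟨hφ (hl y hy).1, (hVU y (hl y hy)).1⟩, ⟨hψ (hl y hy).1, (hVU y (hl y hy)).2⟩⟩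

/-- `Φ` is a homotopy on `S` within `T` from `φ` to `ψ`. -/
structure IsHomotopyOn [TopologicalSpace X] [TopologicalSpace Y] (S : Set X) (T : Set Y)
    (φ ψ : X → Y) (Φ : ℝ × X → Y) : Prop where
  cont : ContinuousOn Φ (Set.Icc 0 1 ×ˢ S)
  maps : Set.MapsTo Φ (Set.Icc 0 1 ×ˢ S) T
  zero : ∀ x ∈ S, Φ (0, x) = φ x
  one : ∀ x ∈ S, Φ (1, x) = ψ x

theorem IsHomotopyOn.cohomologous [PseudoMetricSpace X] [TopologicalSpace Y] {S : Set X} {T : Set Y}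
    {φ ψ : X → Y} {Φ : ℝ × X → Y} (h : IsHomotopyOn S T φ ψ Φ) (hS : IsCompact S) :
    Cohomologous S T φ ψ := by
  intro f hf
  have hK : IsCompact (Set.Icc (0 : ℝ) 1 ×ˢ S) := isCompact_Icc.prod hS
  have key (z : ↥(Set.Icc (0 : ℝ) 1 ×ˢ S)) : ∃ W : Set (ℝ × X), IsOpen W ∧ z.1 ∈ W ∧
      ∃ U : Set Y, (∀ l : List Y, (∀ y ∈ l, y ∈ T ∧ y ∈ U) → δ f l = 0) ∧
        ∀ w ∈ W ∩ Set.Icc (0 : ℝ) 1 ×ˢ S, Φ w ∈ U := by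
    obtain ⟨U, hU, hfU⟩ := hf.2 _ (h.maps z.2)
    obtain ⟨W, hW, hzW, hWU⟩ := mem_nhdsWithin.1 (h.cont z.1 z.2 hU)
    exact ⟨W, hW, hzW, U, hfU, fun w hw => hWU hw⟩
  choose W hWo hWm hWU using key
  obtain ⟨ε, hε, hball⟩ := lebesgue_number_lemma_of_metric hK hWo
    fun z hz => Set.mem_iUnion.2 ⟨⟨z, hz⟩, hWm ⟨z, hz⟩⟩
  obtain ⟨N, hN⟩ := exists_nat_one_div_lt hε
  have hN0 : (0 : ℝ) < N + 1 := by positivity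
  have step (k : ℕ) (hk : k ≤ N + 1) :
      pull (fun x => Φ (0, x)) f - pull (fun x => Φ (k / (N + 1), x)) f ∈ coboundaries S := by
    induction k with
    | zero => simp
    | succ k ih =>
      have hk1 : (k : ℝ) + 1 ≤ N + 1 := by exact_mod_cast hk
      have h1 : (k : ℝ) / (N + 1) ∈ Set.Icc (0 : ℝ) 1 :=
        ⟨by positivity, by rw [div_le_one hN0]; linarith⟩
      have h2 : ((k + 1 : ℕ) : ℝ) / (N + 1) ∈ Set.Icc (0 : ℝ) 1 :=
        ⟨by positivity, by rw [div_le_one hN0]; push_cast; linarith⟩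
      have hc : pull (fun x => Φ (k / (N + 1), x)) f -
          pull (fun x => Φ ((k + 1 : ℕ) / (N + 1), x)) f ∈ coboundaries S := by
        refine cohomologous_of_close (fun x hx => h.maps ⟨h1, hx⟩) (fun x hx => h.maps ⟨h2, hx⟩)
          fun x hx => ?_
        obtain ⟨z, hz⟩ := hball (k / (N + 1), x) ⟨h1, hx⟩
        obtain ⟨U, hfU, hU⟩ := hWU z
        refine ⟨U, hfU, Metric.ball x ε, Metric.ball_mem_nhds x hε, fun y hy => ?_⟩
        constructor
        · refine hU _ ⟨hz ?_, h1, hy.1⟩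
          rw [Metric.mem_ball, Prod.dist_eq, max_lt_iff, _root_.dist_self]
          exact ⟨hε, hy.2⟩
        · refine hU _ ⟨hz ?_, h2, hy.1⟩
          have : |((k + 1 : ℕ) : ℝ) / (N + 1) - k / (N + 1)| < ε := by
            rw [← sub_div]
            push_cast
            rw [add_sub_cancel_left, abs_of_pos (by positivity)]
            exact hN
          rw [Metric.mem_ball, Prod.dist_eq, max_lt_iff, Real.dist_eq]
          exact ⟨this, hy.2⟩
      simpa using add_mem (ih (by omega)) hc
  have h0 : Cohomologous S T φ fun x => Φ (0, x) := .of_eqOn fun x hx => (h.zero x hx).symm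
  have h1 : Cohomologous S T (fun x => Φ (1, x)) ψ := .of_eqOn fun x hx => h.one x hx
  have h2 := step (N + 1) le_rfl
  push_cast at h2
  rw [div_self hN0.ne'] at h2
  simpa using add_mem (h0 f hf) (add_mem h2 (h1 f hf))

/-- Homotopic maps are cohomologous. -/
theorem _root_.ContinuousMap.Homotopy.cohomologous [PseudoMetricSpace X] [CompactSpace X]
    [TopologicalSpace Y] {φ ψ : C(X, Y)} (F : φ.Homotopy ψ) :
    Cohomologous Set.univ Set.univ φ ψ := by
  refine IsHomotopyOn.cohomologous (Φ := fun z => F.extend z.1 z.2) ⟨?_, fun _ _ => trivial, ?_, ?_⟩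
    isCompact_univ
  · refine Continuous.continuousOn ?_
    fun_prop
  · intro x _; simp
  · intro x _; simp

/-- Straight-line homotopies. -/
theorem cohomologous_of_segment {E F : Type} [PseudoMetricSpace E] [AddCommGroup F] [Module ℝ F]
    [TopologicalSpace F] [IsTopologicalAddGroup F] [ContinuousSMul ℝ F]
    {S : Set E} {T : Set F} {φ ψ : E → F} (hS : IsCompact S) (hφ : ContinuousOn φ S)
    (hψ : ContinuousOn ψ S)
    (h : ∀ x ∈ S, ∀ t : ℝ, 0 ≤ t → t ≤ 1 → (1 - t) • φ x + t • ψ x ∈ T) :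
    Cohomologous S T φ ψ := by
  refine IsHomotopyOn.cohomologous (Φ := fun z => (1 - z.1) • φ z.2 + z.1 • ψ z.2)
    ⟨?_, fun z hz => h z.2 hz.2 z.1 hz.1.1 hz.1.2, ?_, ?_⟩ hS
  · have h1 : ContinuousOn (fun z : ℝ × E => φ z.2) (Set.Icc 0 1 ×ˢ S) :=
      hφ.comp continuousOn_snd fun z hz => hz.2
    have h2 : ContinuousOn (fun z : ℝ × E => ψ z.2) (Set.Icc 0 1 ×ˢ S) :=
      hψ.comp continuousOn_snd fun z hz => hz.2
    fun_prop
  · intro x _; simp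
  · intro x _; simp

end Cochain

namespace PWedge

open Cochain

local notation "δ" => coboundary

variable {ι : Type} {P : ι → Type} [∀ i, TopologicalSpace (P i)] {pt : ∀ i, P i}

/-- The base point of a wedge. -/
def base : PWedge P pt := Quot.mk _ (Sum.inr ())

/-- The inclusion of a summand into a wedge. -/
def incl (i : ι) (x : P i) : PWedge P pt := Quot.mk _ (Sum.inl ⟨i, x⟩)

theorem incl_pt (i : ι) : (incl i (pt i) : PWedge P pt) = base :=
  Quot.sound ⟨Or.inr ⟨i, rfl⟩, Or.inl rfl⟩

open Classical in
/-- The projection of a wedge onto a summand. -/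
noncomputable def proj (i : ι) : PWedge P pt → P i :=
  Quot.lift (Sum.elim (fun z => if h : z.1 = i then h ▸ z.2 else pt i) fun _ => pt i) (by
    have key : ∀ a : (Σ i, P i) ⊕ Unit, (a = Sum.inr () ∨ ∃ i, a = Sum.inl ⟨i, pt i⟩) →
        Sum.elim (fun z => if h : z.1 = i then h ▸ z.2 else pt i) (fun _ => pt i) a = pt i := by
      rintro a (rfl | ⟨j, rfl⟩)
      · rfl
      · by_cases h : j = i
        · subst h; simp
        · simp [h]
    rintro a b ⟨ha, hb⟩
    rw [key a ha, key b hb])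

theorem proj_incl (i : ι) (x : P i) : proj i (incl i x : PWedge P pt) = x := by
  simp [proj, incl]

theorem proj_incl_of_ne {i j : ι} (h : i ≠ j) (x : P i) :
    proj j (incl i x : PWedge P pt) = pt j := by
  simp [proj, incl, h]

theorem proj_base (i : ι) : proj i (base : PWedge P pt) = pt i := rfl

theorem eq_base_or (w : PWedge P pt) : w = base ∨ ∃ i x, x ≠ pt i ∧ w = incl i x := by
  induction w using Quot.ind with | mk a => ?_
  rcases a with ⟨i, x⟩ | _
  · by_cases hx : x = pt i
    · subst hx; exact Or.inl (incl_pt i)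
    · exact Or.inr ⟨i, x, hx, rfl⟩
  · exact Or.inl rfl

theorem incl_proj {i : ι} {w : PWedge P pt} (h : proj i w ≠ pt i) : incl i (proj i w) = w := by
  rcases eq_base_or w with rfl | ⟨j, x, -, rfl⟩
  · exact absurd (proj_base i) h
  · by_cases hj : j = i
    · subst hj; rw [proj_incl]
    · exact absurd (proj_incl_of_ne hj x) h

theorem continuous_incl (i : ι) : Continuous (incl i : P i → PWedge P pt) :=
  continuous_quot_mk.comp (continuous_inl.comp continuous_sigmaMk)

theorem continuous_proj (i : ι) : Continuous (proj i : PWedge P pt → P i) := by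
  refine continuous_quot_lift _ (Continuous.sumElim (continuous_sigma fun j => ?_) continuous_const)
  by_cases h : j = i
  · subst h; simpa using continuous_id'
  · simpa [h] using continuous_const

theorem mem_nhds_base {N : ∀ i, Set (P i)} (hN : ∀ i, IsOpen (N i)) (hpt : ∀ i, pt i ∈ N i) :
    {w : PWedge P pt | ∀ i, proj i w ∈ N i} ∈ nhds base := by
  refine IsOpen.mem_nhds ?_ fun i => hpt i
  refine isQuotientMap_quot_mk.isOpen_preimage.1 (isOpen_sum_iff.2 ⟨?_, isOpen_discrete _⟩)
  refine isOpen_sigma_iff.2 fun j => ?_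
  convert hN j using 1
  ext x
  refine ⟨fun h => by simpa using (proj_incl (pt := pt) j x) ▸ h j, fun h i => ?_⟩
  change proj i (incl j x : PWedge P pt) ∈ N i
  by_cases hj : j = i
  · subst hj; rwa [proj_incl]
  · rw [proj_incl_of_ne hj]; exact hpt i

/-- Pointed homotopies of the summands induce a homotopy of the wedge. -/
noncomputable def extend (s : ∀ i, C(P i, C(ℝ, P i))) (hs : ∀ i t, s i (pt i) t = pt i) :
    PWedge P pt → C(ℝ, PWedge P pt) :=
  Quot.lift (Sum.elim (fun z => (⟨incl z.1, continuous_incl z.1⟩ : C(_, _)).comp (s z.1 z.2))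
      fun _ => ContinuousMap.const _ base) (by
    have key : ∀ a : (Σ i, P i) ⊕ Unit, (a = Sum.inr () ∨ ∃ i, a = Sum.inl ⟨i, pt i⟩) →
        Sum.elim (fun z => (⟨incl z.1, continuous_incl z.1⟩ : C(_, PWedge P pt)).comp (s z.1 z.2))
          (fun _ => ContinuousMap.const ℝ (base : PWedge P pt)) a = ContinuousMap.const ℝ base := by
      rintro a (rfl | ⟨j, rfl⟩)
      · rfl
      · ext t
        simp [hs, incl_pt]
    rintro a b ⟨ha, hb⟩
    rw [key a ha, key b hb])

theorem extend_incl (s : ∀ i, C(P i, C(ℝ, P i))) (hs : ∀ i t, s i (pt i) t = pt i) (i : ι) (x : P i)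
    (t : ℝ) : extend s hs (incl i x) t = incl i (s i x t) := rfl

theorem extend_base (s : ∀ i, C(P i, C(ℝ, P i))) (hs : ∀ i t, s i (pt i) t = pt i)
    (t : ℝ) : extend s hs (base : PWedge P pt) t = base := rfl

theorem continuous_extend (s : ∀ i, C(P i, C(ℝ, P i))) (hs : ∀ i t, s i (pt i) t = pt i) :
    Continuous (extend s hs) := by
  refine continuous_quot_lift _ (Continuous.sumElim (continuous_sigma fun j => ?_) continuous_const)
  exact (ContinuousMap.continuous_postcomp (⟨incl j, continuous_incl j⟩ : C(_, PWedge P pt))).comp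
    (s j).continuous

/-- A cocycle on a wedge whose restriction to each summand is a coboundary pulls back to a
coboundary on every compact metric space. -/
theorem pull_mem_coboundaries_of_incl [∀ i, T1Space (P i)] (s : ∀ i, C(P i, C(ℝ, P i)))
    (hs : ∀ i t, s i (pt i) t = pt i) (hs0 : ∀ i x, s i x 0 = x) (N : ∀ i, Set (P i))
    (hN : ∀ i, IsOpen (N i)) (hpt : ∀ i, pt i ∈ N i) (hs1 : ∀ i, ∀ x ∈ N i, s i x 1 = pt i)
    {F : Cochain (PWedge P pt)} (hF : δ F ∈ negligible Set.univ)
    (hFi : ∀ i, pull (incl i) F ∈ coboundaries (Set.univ : Set (P i)))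
    {X : Type} [PseudoMetricSpace X] [CompactSpace X] (φ : C(X, PWedge P pt)) :
    pull φ F ∈ coboundaries (Set.univ : Set X) := by
  classical
  obtain ⟨F₁, hF₁⟩ : ∃ F₁, F₁ = F - pull (fun _ => base) F := ⟨_, rfl⟩
  have hF₁base : ∀ l : List (PWedge P pt), (∀ w ∈ l, w = base) → F₁ l = 0 := by
    intro l hl
    rw [hF₁, Pi.sub_apply, pull_apply,
      show l.map (fun _ => base) = l from
        (List.map_congr_left fun w hw => (hl w hw).symm).trans (List.map_id l), sub_self]
  have hδF₁ : δ F₁ ∈ negligible Set.univ := by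
    rw [hF₁, map_sub]
    exact sub_mem hF (coboundary_pull_mem continuousOn_const (Set.mapsTo_univ _ _) hF)
  have hF₁i (i : ι) : pull (incl i) F₁ ∈ coboundaries (Set.univ : Set (P i)) := by
    rw [hF₁, map_sub, pull_pull]
    exact sub_mem (hFi i) (pull_const_mem (Set.mem_univ _) hF)
  have hg (i : ι) : ∃ g : Cochain (P i), pull (incl i) F₁ - δ g ∈ negligible Set.univ ∧
      ∀ l : List (P i), (∀ x ∈ l, x = pt i) → g l = 0 := by
    obtain ⟨g, hg⟩ := mem_coboundaries.1 (hF₁i i)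
    refine ⟨g - pull (fun _ => pt i) g, ?_, fun l hl => ?_⟩
    · have h0 : δ (pull (fun _ : P i => pt i) g) = 0 := by
        rw [coboundary_pull]
        ext l
        obtain ⟨U, hU, hUg⟩ := hg.2 (pt i) trivial
        have h1 := hUg (l.map fun _ => pt i) (by simpa using fun _ => mem_of_mem_nhds hU)
        rw [Pi.sub_apply, pull_apply, hF₁base _ (by simp [incl_pt]), zero_sub, neg_eq_zero] at h1
        exact h1
      rwa [map_sub, h0, sub_zero]
    · rw [Pi.sub_apply, pull_apply,
        (List.map_congr_left fun w hw => (hl w hw).symm : l.map (fun _ => pt i) = l.map fun x => x),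
        List.map_id', sub_self]
  choose g hg hgpt using hg
  let G : Cochain (PWedge P pt) := fun l =>
    if h : ∃ i, ∀ x ∈ l, x ∈ Set.range (incl i) then g h.choose (l.map (proj h.choose)) else 0
  have hG (i : ι) : pull (incl i) G = g i := by
    ext l
    have h : ∃ j, ∀ x ∈ l.map (incl i), x ∈ Set.range (incl j : P j → PWedge P pt) :=
      ⟨i, by simp⟩
    have key (j : ι) (hj : ∀ x ∈ l.map (incl i), x ∈ Set.range (incl j : P j → PWedge P pt)) :
        g j ((l.map (incl (pt := pt) i)).map (proj j)) = g i l := by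
      by_cases hij : i = j
      · subst hij
        rw [List.map_map, show proj i ∘ incl (pt := pt) i = id from funext (proj_incl i),
          List.map_id]
      · rw [hgpt i, hgpt j]
        · simpa using fun x _ => proj_incl_of_ne hij x
        · intro x hx
          obtain ⟨y, hy⟩ := hj _ (List.mem_map_of_mem hx)
          rw [← proj_incl (pt := pt) i x, ← hy, proj_incl_of_ne (Ne.symm hij)]
    rw [pull_apply]
    simp only [G]
    rw [dif_pos h]
    exact key _ h.choose_spec
  have hGbase : ∀ l : List (PWedge P pt), (∀ w ∈ l, w = base) → G l = 0 := by
    intro l hl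
    simp only [G]
    split_ifs with h
    · refine hgpt _ _ ?_
      simp only [List.mem_map, forall_exists_index, and_imp]
      rintro _ w hw rfl
      rw [hl w hw, proj_base]
    · rfl
  obtain ⟨ν, hν⟩ : ∃ ν, ν = F₁ - δ G := ⟨_, rfl⟩
  have hνbase : ∀ l : List (PWedge P pt), (∀ w ∈ l, w = base) → ν l = 0 := by
    intro l hl
    rw [hν, Pi.sub_apply, hF₁base l hl,
      coboundary_eq_zero fun l' hl' _ => hGbase l' fun w hw => hl w (hl' hw), sub_zero]
  have hνi (i : ι) : pull (incl i) ν ∈ negligible (Set.univ : Set (P i)) := by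
    rw [hν, map_sub, ← coboundary_pull, hG]
    exact hg i
  let r : PWedge P pt → PWedge P pt := fun w => extend s hs w 1
  have hr : Continuous r := (continuous_eval_const (1 : ℝ)).comp (continuous_extend s hs)
  have hrν : pull r ν ∈ negligible (Set.univ : Set (PWedge P pt)) := by
    refine ⟨hνbase _ (by simp), fun w _ => ?_⟩
    rcases eq_base_or w with rfl | ⟨i, x, hx, rfl⟩
    · refine ⟨_, mem_nhds_base hN hpt, fun l hl => hνbase _ ?_⟩
      simp only [List.mem_map, forall_exists_index, and_imp]
      rintro _ w hw rfl
      have hw' := (hl w hw).2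
      rcases eq_base_or w with rfl | ⟨j, y, -, rfl⟩
      · rfl
      · have hj : y ∈ N j := by simpa [proj_incl] using hw' j
        simp only [r]
        rw [extend_incl, hs1 j y hj, incl_pt]
    · have hsc : Continuous fun y => s i y 1 :=
        (continuous_eval_const (1 : ℝ)).comp (s i).continuous
      obtain ⟨V, hV, hVν⟩ :=
        (pull_mem_negligible hsc.continuousOn (Set.mapsTo_univ _ _) (hνi i)).2 x
          (Set.mem_univ x)
      have hW : V ∩ {pt i}ᶜ ∈ nhds (proj i (incl i x : PWedge P pt)) := by
        rw [proj_incl]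
        exact Filter.inter_mem hV (isOpen_compl_singleton.mem_nhds hx)
      refine ⟨_, (continuous_proj i).continuousAt.preimage_mem_nhds hW, fun l hl => ?_⟩
      have h1 := hVν (l.map (proj i)) (by
        simpa using fun w hw => (hl w hw).2.1)
      rw [← h1]
      simp only [pull_apply, List.map_map]
      congr 1
      refine List.map_congr_left fun w hw => ?_
      have h2 := incl_proj (hl w hw).2.2
      simp only [Function.comp_apply, r]
      rw [← extend_incl s hs, h2]
  have hrF : pull r F₁ ∈ coboundaries (Set.univ : Set (PWedge P pt)) := by
    have : F₁ = ν + δ G := by rw [hν]; abel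
    rw [this, map_add, ← coboundary_pull]
    exact add_mem (negligible_le_coboundaries _ hrν) (coboundary_mem_coboundaries _)
  have hhom : Cohomologous Set.univ Set.univ φ fun x => r (φ x) := by
    refine IsHomotopyOn.cohomologous (Φ := fun z => extend s hs (φ z.2) z.1)
      ⟨?_, fun _ _ => trivial, ?_, fun _ _ => rfl⟩ isCompact_univ
    · refine Continuous.continuousOn ?_
      have := continuous_extend s hs
      fun_prop
    · intro x _
      rcases eq_base_or (φ x) with h | ⟨i, y, -, h⟩
      · rw [h, extend_base]
      · rw [h, extend_incl, hs0]
  have h1 : pull φ F₁ ∈ coboundaries (Set.univ : Set X) := by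
    have h2 := pull_mem_coboundaries φ.continuous.continuousOn (Set.mapsTo_univ _ Set.univ) hrF
    rw [pull_pull] at h2
    simpa using add_mem (hhom F₁ hδF₁) h2
  have h3 : pull φ F = pull φ F₁ + pull (fun _ => base) F := by
    rw [hF₁, map_sub, pull_pull]; abel
  rw [h3]
  exact add_mem h1 (pull_const_mem (Set.mem_univ _) hF)

end PWedge

namespace SphereD

/-- The point on the sphere in the direction of a nonzero vector. -/
noncomputable def dir {d : ℕ} (v : EuclideanSpace ℝ (Fin (d + 1))) (hv : v ≠ 0) : SphereD d :=
  ⟨‖v‖⁻¹ • v, by simp [norm_smul, hv]⟩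

/-- A homotopy of the identity of the sphere that collapses a cap around the base point. -/
noncomputable def squashVec (d : ℕ) (z : SphereD d × ℝ) : EuclideanSpace ℝ (Fin (d + 1)) :=
  (1 - z.2 * max 0 (min 1 (2 * z.1.1 0))) • z.1.1 +
    (z.2 * max 0 (min 1 (2 * z.1.1 0)) * z.1.1 0) • (pt d).1

theorem squashVec_ne_zero (d : ℕ) (z : SphereD d × ℝ) : squashVec d z ≠ 0 := by
  intro h
  have h0 : squashVec d z 0 = z.1.1 0 := by
    simp [squashVec, pt]
    ring
  have h1 : z.1.1 0 = 0 := by rw [← h0, h]; rfl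
  have h2 : squashVec d z = z.1.1 := by simp [squashVec, h1]
  have h3 : ‖z.1.1‖ = 1 := by simp
  rw [← h2, h] at h3
  simp at h3

theorem continuous_squashVec (d : ℕ) : Continuous (squashVec d) := by
  unfold squashVec
  fun_prop

theorem exists_squash (d : ℕ) : ∃ s : C(SphereD d, C(ℝ, SphereD d)), (∀ t, s (pt d) t = pt d) ∧
    (∀ x, s x 0 = x) ∧ ∃ N : Set (SphereD d), IsOpen N ∧ pt d ∈ N ∧ ∀ x ∈ N, s x 1 = pt d := by
  let S : C(SphereD d × ℝ, SphereD d) := ⟨fun z => dir (squashVec d z) (squashVec_ne_zero d z), by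
    refine Continuous.subtype_mk ?_ _
    exact ((continuous_squashVec d).norm.inv₀ fun z =>
      norm_ne_zero_iff.2 (squashVec_ne_zero d z)).smul (continuous_squashVec d)⟩
  have hpt : (pt d).1 0 = 1 := by simp [pt]
  refine ⟨S.curry, fun t => ?_, fun x => ?_, {x | 1 / 2 < x.1 0}, ?_, ?_, fun x hx => ?_⟩
  · have : squashVec d (pt d, t) = (pt d).1 := by
      simp only [squashVec, hpt]
      rw [← add_smul]
      convert one_smul ℝ _ using 2
      ring
    refine Subtype.ext ?_
    simp [S, dir, this]
  · refine Subtype.ext ?_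
    simp [S, dir, squashVec]
  · exact isOpen_lt continuous_const (by fun_prop)
  · simp only [Set.mem_ofPred_eq, hpt]; norm_num
  · simp only [Set.mem_ofPred_eq] at hx
    have h1 : squashVec d (x, 1) = x.1 0 • (pt d).1 := by
      have : max 0 (min 1 (2 * x.1 0)) = 1 := by
        rw [min_eq_left (by linarith)]; simp
      simp [squashVec, this]
    have h2 : 0 < x.1 0 := by linarith
    refine Subtype.ext ?_
    simp only [ContinuousMap.curry_apply, ContinuousMap.coe_mk, S, dir, h1, norm_smul]
    rw [smul_smul]
    convert one_smul ℝ _ using 2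
    simp [abs_of_pos h2, h2.ne']

end SphereD

namespace Realization

open Cochain

local notation "δ" => coboundary

section DecidableEq

variable {α : Type} [DecidableEq α]

theorem single_nonneg (p a : α) : 0 ≤ (Pi.single p 1 : α → ℝ) a := by
  rw [Pi.single_apply]; split_ifs <;> norm_num

theorem single_support {p a : α} (h : (Pi.single p 1 : α → ℝ) a ≠ 0) : a = p := by
  by_contra hne
  exact h (by rw [Pi.single_apply, if_neg hne])

/-- The deletion of a vertex. -/
def del (K : Set (Finset α)) (p : α) : Set (Finset α) := {s ∈ K | p ∉ s}

/-- The link of a vertex. -/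
def link (K : Set (Finset α)) (p : α) : Set (Finset α) := {s | p ∉ s ∧ insert p s ∈ K}

/-- The radial projection away from the vertex `p`. -/
noncomputable def away (p : α) (f : α → ℝ) : α → ℝ :=
  fun a => if a = p then 0 else (1 - f p)⁻¹ * f a

/-- The midpoint with the vertex `p`. -/
noncomputable def toward (p : α) (f : α → ℝ) : α → ℝ := fun a => if a = p then 1 / 2 else f a / 2

theorem away_nonneg {f : α → ℝ} {p : α} (hf : ∀ a, 0 ≤ f a) (hp : f p ≤ 2 / 3) (a : α) :
    0 ≤ away p f a := by
  have : 0 < 1 - f p := by linarith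
  simp only [away]
  split_ifs
  · rfl
  · exact mul_nonneg (inv_nonneg.2 this.le) (hf a)

theorem away_support {f : α → ℝ} {p a : α} (h : away p f a ≠ 0) : a ≠ p ∧ f a ≠ 0 := by
  by_cases ha : a = p
  · simp [away, ha] at h
  · exact ⟨ha, fun h0 => h (by simp [away, h0])⟩

theorem away_self (p : α) (f : α → ℝ) : away p f p = 0 := by simp [away]

theorem away_of_eq_zero {f : α → ℝ} {p : α} (h : f p = 0) : away p f = f := by
  ext a
  by_cases ha : a = p
  · simp [away, ha, h]
  · simp [away, ha, h]

theorem away_toward {f : α → ℝ} {p : α} (h : f p = 0) : away p (toward p f) = f := by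
  ext a
  by_cases ha : a = p
  · simp [away, ha, h]
  · simp [away, toward, ha]
    ring

theorem toward_nonneg {f : α → ℝ} {p : α} (hf : ∀ a, 0 ≤ f a) (a : α) : 0 ≤ toward p f a := by
  simp only [toward]
  split_ifs
  · norm_num
  · linarith [hf a]

theorem toward_support {f : α → ℝ} {p a : α} (h : toward p f a ≠ 0) : a = p ∨ f a ≠ 0 := by
  by_cases ha : a = p
  · exact Or.inl ha
  · exact Or.inr fun h0 => h (by simp [toward, ha, h0])

theorem continuous_toward (p : α) : Continuous (toward p) := by
  refine continuous_pi fun a => ?_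
  by_cases ha : a = p
  · simp [toward, ha, continuous_const]
  · simp only [toward, ha, if_false]; fun_prop

theorem continuousOn_away {S : Set (α → ℝ)} {p : α} (h : ∀ f ∈ S, f p ≤ 2 / 3) :
    ContinuousOn (away p) S := by
  refine continuousOn_pi.2 fun a => ?_
  by_cases ha : a = p
  · simp [away, ha, continuousOn_const]
  · simp only [away, ha, if_false]
    refine ContinuousOn.mul (ContinuousOn.inv₀ (by fun_prop) fun f hf => ?_) (by fun_prop)
    linarith [h f hf]

end DecidableEq

variable {α : Type} [Fintype α]

/-- The geometric realization of a complex on a finite vertex set, as a set of functions. -/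
def points (K : Set (Finset α)) : Set (α → ℝ) :=
  {f | (∀ a, 0 ≤ f a) ∧ ∑ a, f a = 1 ∧ ∃ s ∈ K, ∀ a, f a ≠ 0 → a ∈ s}

theorem isCompact_points (K : Set (Finset α)) : IsCompact (points K) := by
  have h : points K = stdSimplex ℝ α ∩ ⋃ s ∈ K, ⋂ a ∈ (s : Set α)ᶜ, {f : α → ℝ | f a = 0} := by
    ext f
    simp only [points, stdSimplex, Set.mem_ofPred_eq, Set.mem_inter_iff, Set.mem_iUnion,
      Set.mem_iInter, Set.mem_compl_iff, Finset.mem_coe, exists_prop, and_assoc]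
    simp only [not_imp_comm, ne_eq]
  rw [h]
  refine (isCompact_stdSimplex ℝ α).inter_right ((Set.toFinite K).isClosed_biUnion fun s _ => ?_)
  exact isClosed_biInter fun a _ => isClosed_eq (continuous_apply a) continuous_const

theorem points_mono {K L : Set (Finset α)} (h : K ⊆ L) : points K ⊆ points L :=
  fun _ hf => ⟨hf.1, hf.2.1, hf.2.2.imp fun _ hs => ⟨h hs.1, hs.2⟩⟩

theorem segment_mem_points {K : Set (Finset α)} {f g : α → ℝ} {s : Finset α} (hs : s ∈ K)
    (hf : ∀ a, 0 ≤ f a) (hf1 : ∑ a, f a = 1) (hfs : ∀ a, f a ≠ 0 → a ∈ s)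
    (hg : ∀ a, 0 ≤ g a) (hg1 : ∑ a, g a = 1) (hgs : ∀ a, g a ≠ 0 → a ∈ s)
    {t : ℝ} (h0 : 0 ≤ t) (h1 : t ≤ 1) : (1 - t) • f + t • g ∈ points K := by
  refine ⟨fun a => ?_, ?_, s, hs, fun a ha => ?_⟩
  · exact add_nonneg (mul_nonneg (by linarith) (hf a)) (mul_nonneg h0 (hg a))
  · simp [Finset.sum_add_distrib, ← Finset.mul_sum, hf1, hg1]
  · by_contra has
    refine ha ?_
    simp [not_imp_comm.1 (hfs a) has, not_imp_comm.1 (hgs a) has]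

variable [DecidableEq α]

theorem single_mem_points {K : Set (Finset α)} {p : α} (hp : {p} ∈ K) :
    (Pi.single p 1 : α → ℝ) ∈ points K :=
  ⟨single_nonneg p, by simp, _, hp, fun _ ha => Finset.mem_singleton.2 (single_support ha)⟩

theorem mem_coboundaries_of_cone {K : Set (Finset α)} {q : α} (hq : {q} ∈ K)
    (hK : ∀ s ∈ K, insert q s ∈ K) {f : Cochain (α → ℝ)} (hf : δ f ∈ negligible (points K)) :
    f ∈ coboundaries (points K) := by
  rw [← pull_id f]
  refine Cohomologous.mem_coboundaries_of_const (φ := id) (T := points K) (single_mem_points hq)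
    (cohomologous_of_segment (isCompact_points K) continuousOn_id continuousOn_const ?_) hf
  intro x hx t h0 h1
  obtain ⟨s, hs, hxs⟩ := hx.2.2
  exact segment_mem_points (hK s hs) hx.1 hx.2.1 (fun a ha => Finset.mem_insert_of_mem (hxs a ha))
    (single_nonneg q) (by simp) (fun a ha => single_support ha ▸ Finset.mem_insert_self _ _) h0 h1

theorem betti_eq_zero_of_cone {K : Set (Finset α)} {q : α} (hq : {q} ∈ K)
    (hK : ∀ s ∈ K, insert q s ∈ K) (n : ℕ) : betti n (points K) = 0 :=
  betti_eq_zero fun _ hf => mem_coboundaries_of_cone hq hK hf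

theorem sum_erase_eq {f : α → ℝ} (h : ∑ a, f a = 1) (p : α) :
    ∑ a ∈ Finset.univ.erase p, f a = 1 - f p := by
  rw [← h, ← Finset.add_sum_erase _ _ (Finset.mem_univ p)]; ring

theorem sum_away {f : α → ℝ} {p : α} (hf : ∑ a, f a = 1) (hp : f p ≤ 2 / 3) :
    ∑ a, away p f a = 1 := by
  have : 1 - f p ≠ 0 := by linarith
  rw [← Finset.add_sum_erase _ _ (Finset.mem_univ p), Finset.sum_congr rfl fun a ha =>
    show away p f a = (1 - f p)⁻¹ * f a from if_neg (Finset.ne_of_mem_erase ha), ← Finset.mul_sum,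
    sum_erase_eq hf, inv_mul_cancel₀ this]
  simp [away]

theorem sum_toward {f : α → ℝ} {p : α} (hf : ∑ a, f a = 1) (hp : f p = 0) :
    ∑ a, toward p f a = 1 := by
  rw [← Finset.add_sum_erase _ _ (Finset.mem_univ p), Finset.sum_congr rfl fun a ha =>
    show toward p f a = f a / 2 from if_neg (Finset.ne_of_mem_erase ha), ← Finset.sum_div,
    sum_erase_eq hf, hp]
  simp [toward]; norm_num

/-- The long exact sequence of a vertex dominated in the complex by another vertex. -/
theorem betti_points_eq {K : Set (Finset α)} (hK : IsLowerSet K) {p q : α} (hp : {p} ∈ K)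
    (hpq : p ≠ q) (hdom : ∀ s, p ∉ s → insert p s ∈ K → insert q s ∈ K) (n : ℕ) :
    betti (n + 1) (points K) = betti n (points (link K p)) + betti (n + 1) (points (del K p)) := by
  have hq : {q} ∈ K := by simpa using hdom ∅ (by simp) (by simpa using hp)
  obtain ⟨A, hA⟩ : ∃ A, A = {f ∈ points K | 1 / 3 ≤ f p} := ⟨_, rfl⟩
  obtain ⟨B, hB⟩ : ∃ B, B = {f ∈ points K | f p ≤ 2 / 3} := ⟨_, rfl⟩
  have hAB : A ∪ B = points K := by
    ext f
    simp only [hA, hB, Set.mem_union, Set.mem_ofPred_eq, ← and_or_left, and_iff_left_iff_imp]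
    intro _
    by_contra! h
    linarith
  have hAc : IsCompact A := by
    rw [hA]
    exact (isCompact_points K).inter_right (isClosed_le continuous_const (continuous_apply p))
  have hBc : IsCompact B := by
    rw [hB]
    exact (isCompact_points K).inter_right (isClosed_le (continuous_apply p) continuous_const)
  have hABc : IsCompact (A ∩ B) := hAc.inter hBc
  have hface {f : α → ℝ} (hf : f ∈ points K) : ∃ s ∈ K, ∀ a, f a ≠ 0 → a ∈ s := hf.2.2
  have hBle : ∀ f ∈ B, f p ≤ 2 / 3 := fun f hf => (hB ▸ hf).2
  have hABle : ∀ f ∈ A ∩ B, f p ≤ 2 / 3 := fun f hf => hBle f hf.2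
  have hBK : ∀ f ∈ B, f ∈ points K := fun f hf => (hB ▸ hf).1
  have hAge : ∀ f ∈ A, 1 / 3 ≤ f p := fun f hf => (hA ▸ hf).2
  have hawayB : ∀ f ∈ B, ∀ t : ℝ, 0 ≤ t → t ≤ 1 → (1 - t) • away p f + t • f ∈ B := by
    intro f hf t h0 h1
    obtain ⟨s, hs, hfs⟩ := hface (hBK f hf)
    have hf' := hBK f hf
    rw [hB]
    refine ⟨segment_mem_points hs (away_nonneg hf'.1 (hBle f hf)) (sum_away hf'.2.1 (hBle f hf))
      (fun a ha => hfs a (away_support ha).2) hf'.1 hf'.2.1 hfs h0 h1, ?_⟩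
    have h2 := hBle f hf
    have h3 := hf'.1 p
    simp only [Pi.add_apply, Pi.smul_apply, away_self, smul_eq_mul, mul_zero, zero_add]
    nlinarith
  have hdel : betti (n + 1) B = betti (n + 1) (points (del K p)) := by
    have hmaps : Set.MapsTo (away p) B (points (del K p)) := by
      intro f hf
      obtain ⟨s, hs, hfs⟩ := hface (hBK f hf)
      refine ⟨away_nonneg (hBK f hf).1 (hBle f hf), sum_away (hBK f hf).2.1 (hBle f hf), s.erase p,
        ⟨hK (Finset.erase_subset p s) hs, Finset.notMem_erase p s⟩, fun a ha => ?_⟩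
      exact Finset.mem_erase.2 ⟨(away_support ha).1, hfs a (away_support ha).2⟩
    have hzero : ∀ f ∈ points (del K p), f p = 0 := by
      intro f hf
      obtain ⟨s, hs, hfs⟩ := hf.2.2
      exact not_imp_comm.1 (hfs p) hs.2
    refine betti_eq_of_cohomologous (φ := away p) (ψ := id) (continuousOn_away hBle) hmaps
      continuousOn_id ?_ ?_ ?_ (n + 1)
    · intro f hf
      rw [hB]
      refine ⟨points_mono (fun s hs => hs.1) hf, ?_⟩
      rw [id, hzero f hf]; norm_num
    · exact cohomologous_of_segment hBc (continuousOn_away hBle) continuousOn_id hawayB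
    · exact Cohomologous.of_eqOn fun f hf => away_of_eq_zero (hzero f hf)
  have hmapsL : Set.MapsTo (away p) (A ∩ B) (points (link K p)) := by
    intro f hf
    obtain ⟨s, hs, hfs⟩ := hface (hBK f hf.2)
    have hps : p ∈ s := hfs p (by linarith [hAge f hf.1])
    refine ⟨away_nonneg (hBK f hf.2).1 (hABle f hf), sum_away (hBK f hf.2).2.1 (hABle f hf),
      s.erase p, ⟨Finset.notMem_erase p s, by rwa [Finset.insert_erase hps]⟩, fun a ha => ?_⟩
    exact Finset.mem_erase.2 ⟨(away_support ha).1, hfs a (away_support ha).2⟩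
  have hlink : betti n (A ∩ B) = betti n (points (link K p)) := by
    have hzero : ∀ f ∈ points (link K p), f p = 0 := by
      intro f hf
      obtain ⟨s, hs, hfs⟩ := hf.2.2
      exact not_imp_comm.1 (hfs p) hs.1
    refine betti_eq_of_cohomologous (φ := away p) (ψ := toward p) (continuousOn_away hABle) hmapsL
      (continuous_toward p).continuousOn ?_ ?_ ?_ n
    · intro f hf
      obtain ⟨s, hs, hfs⟩ := hf.2.2
      have h1 : toward p f ∈ points K := by
        refine ⟨toward_nonneg hf.1, sum_toward hf.2.1 (hzero f hf), _, hs.2, fun a ha => ?_⟩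
        exact Finset.mem_insert.2 ((toward_support ha).imp_right (hfs a))
      have h2 : toward p f p = 1 / 2 := by simp [toward]
      rw [hA, hB]
      exact ⟨⟨h1, by rw [h2]; norm_num⟩, ⟨h1, by rw [h2]; norm_num⟩⟩
    · refine cohomologous_of_segment hABc ((continuous_toward p).comp_continuousOn
        (continuousOn_away hABle)) continuousOn_id fun f hf t h0 h1 => ?_
      have hf' := hBK f hf.2
      obtain ⟨s, hs, hfs⟩ := hface hf'
      have hps : p ∈ s := hfs p (by linarith [hAge f hf.1])
      have h2 : (1 - t) • toward p (away p f) + t • f ∈ points K := by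
        refine segment_mem_points hs (toward_nonneg (away_nonneg hf'.1 (hABle f hf)))
          (sum_toward (sum_away hf'.2.1 (hABle f hf)) (away_self p f)) (fun a ha => ?_)
          hf'.1 hf'.2.1 hfs h0 h1
        rcases toward_support ha with rfl | ha
        · exact hps
        · exact hfs a (away_support ha).2
      have h3 : ((1 - t) • toward p (away p f) + t • f) p = (1 - t) * (1 / 2) + t * f p := by
        simp [toward]
      have h4 := hAge f hf.1
      have h5 := hABle f hf
      rw [hA, hB]
      refine ⟨⟨h2, ?_⟩, ⟨h2, ?_⟩⟩ <;> simp only [Function.comp_apply, id] <;> rw [h3] <;> nlinarith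
    · exact Cohomologous.of_eqOn fun f hf => away_toward (hzero f hf)
  rw [← hAB, ← hdel, ← hlink]
  refine betti_union hAc.isClosed hBc.isClosed ?_ ?_ ?_ n
  · intro f _
    rw [hAB, hA, hB]
    by_cases h : 1 / 3 < f p
    · exact Or.inl ⟨_, (isOpen_lt continuous_const (continuous_apply p)).mem_nhds h,
        fun g hg => ⟨hg.2, le_of_lt hg.1⟩⟩
    · refine Or.inr ⟨_, (isOpen_lt (continuous_apply p) continuous_const).mem_nhds
        (show f p < 2 / 3 by linarith), fun g hg => ⟨hg.2, le_of_lt hg.1⟩⟩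
  · intro f hf
    rw [← pull_id f]
    refine Cohomologous.mem_coboundaries_of_const (φ := id) (T := A) (c := Pi.single p 1) ?_
      (cohomologous_of_segment hAc continuousOn_id continuousOn_const fun g hg t h0 h1 => ?_) hf
    · rw [hA]
      exact ⟨single_mem_points hp, by simp; norm_num⟩
    · have h2 := hAge g hg
      rw [hA] at hg ⊢
      obtain ⟨s, hs, hgs⟩ := hface hg.1
      have hps : p ∈ s := hgs p (by linarith)
      refine ⟨segment_mem_points hs hg.1.1 hg.1.2.1 hgs (single_nonneg p) (by simp)
        (fun a ha => single_support ha ▸ hps) h0 h1, ?_⟩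
      simp only [Pi.add_apply, Pi.smul_apply, Pi.single_eq_same, smul_eq_mul, id]
      nlinarith
  · intro f hf
    have h₁ : Cohomologous (A ∩ B) B id (away p) :=
      (cohomologous_of_segment hABc (continuousOn_away hABle) continuousOn_id
        fun g hg => hawayB g hg.2).symm
    have h₂ : Cohomologous (A ∩ B) B (away p) fun _ => Pi.single q 1 := by
      refine cohomologous_of_segment hABc (continuousOn_away hABle) continuousOn_const
        fun g hg t h0 h1 => ?_
      have hl := hmapsL hg
      obtain ⟨s, hs, hgs⟩ := hl.2.2
      rw [hB]
      refine ⟨segment_mem_points (hdom s hs.1 hs.2) hl.1 hl.2.1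
        (fun a ha => Finset.mem_insert_of_mem (hgs a ha)) (single_nonneg q) (by simp)
        (fun a ha => single_support ha ▸ Finset.mem_insert_self _ _) h0 h1, ?_⟩
      simp [away_self, hpq]
      norm_num
    rw [← pull_id f]
    refine (h₁.trans h₂).mem_coboundaries_of_const ?_ hf
    rw [hB]
    exact ⟨single_mem_points hq, by simp [hpq]; norm_num⟩

end Realization

namespace Cochain

theorem betti_subtype {X : Type} [TopologicalSpace X] (S : Set X) (n : ℕ) :
    betti n (Set.univ : Set S) = betti n S := by
  classical
  rcases S.eq_empty_or_nonempty with rfl | ⟨x₀, hx₀⟩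
  · rw [Set.eq_empty_of_isEmpty (Set.univ : Set (∅ : Set X)), betti_empty, betti_empty]
  · let ψ : X → S := fun x => if h : x ∈ S then ⟨x, h⟩ else ⟨x₀, hx₀⟩
    have hψ (x : X) (hx : x ∈ S) : (ψ x : X) = x := by simp [ψ, hx]
    refine betti_eq_of_cohomologous (φ := Subtype.val) (ψ := ψ) continuous_subtype_val.continuousOn
      (fun x _ => x.2) ?_ (Set.mapsTo_univ _ _) (Cohomologous.of_eqOn fun x _ => ?_)
      (Cohomologous.of_eqOn hψ) n
    · rw [Topology.IsInducing.subtypeVal.continuousOn_iff]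
      exact continuousOn_id.congr hψ
    · exact Subtype.ext (hψ x x.2)

end Cochain

namespace Realization

open Cochain

theorem link_del {α : Type} [DecidableEq α] {K : Set (Finset α)} {p p' : α} (hne : p' ≠ p)
    (h : ∀ s ∈ K, p ∈ s → p' ∈ s → p = p') : link (del K p) p' = link K p' := by
  ext s
  simp only [link, del, Set.mem_ofPred_eq, and_congr_right_iff, and_iff_left_iff_imp]
  exact fun _ hs hp => hne (h _ hs hp (Finset.mem_insert_self _ _)).symm

theorem isLowerSet_del {α : Type} {K : Set (Finset α)} (hK : IsLowerSet K) (p : α) :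
    IsLowerSet (del K p) :=
  fun _ _ hst hs => ⟨hK hst hs.1, fun hp => hs.2 (hst hp)⟩

variable {α β : Type} [Fintype α] [Fintype β] [DecidableEq α]

/-- If the faces avoiding a set `D` of pairwise non-adjacent vertices form a cone, whose apex
dominates each vertex of `D`, then the cohomology splits as a sum over the links. -/
theorem betti_points_eq_sum {K : Set (Finset α)} (hK : IsLowerSet K) {q : α} (hq : {q} ∈ K)
    (D : Finset α) (hqD : q ∉ D) (hvert : ∀ p ∈ D, {p} ∈ K)
    (hdom : ∀ p ∈ D, ∀ s, p ∉ s → insert p s ∈ K → insert q s ∈ K)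
    (hD : ∀ s ∈ K, ∀ a ∈ D, ∀ b ∈ D, a ∈ s → b ∈ s → a = b)
    (hcone : ∀ s ∈ K, (∀ p ∈ D, p ∉ s) → insert q s ∈ K) (n : ℕ) :
    betti (n + 1) (points K) = ∑ p ∈ D, betti n (points (link K p)) := by
  induction D using Finset.induction_on generalizing K with
  | empty => exact betti_eq_zero_of_cone hq (fun s hs => hcone s hs (by simp)) _
  | insert p D hp ih =>
    have hpq : p ≠ q := fun h => hqD (h ▸ Finset.mem_insert_self _ _)
    have hne {a : α} (ha : a ∈ D) : a ≠ p := fun h => hp (h ▸ ha)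
    have hmem {a : α} (ha : a ∈ D) : a ∈ insert p D := Finset.mem_insert_of_mem ha
    have hp' := Finset.mem_insert_self p D
    rw [betti_points_eq hK (hvert p hp') hpq (hdom p hp'), Finset.sum_insert hp,
      ih (isLowerSet_del hK p) ⟨hq, by simpa using hpq⟩ fun h => hqD (hmem h)]
    · congr 1
      refine Finset.sum_congr rfl fun a ha => ?_
      rw [link_del (hne ha) fun s hs => hD s hs p hp' a (hmem ha)]
    · exact fun a ha => ⟨hvert a (hmem ha), by simpa using (hne ha).symm⟩
    · refine fun a ha s has hs => ⟨hdom a (hmem ha) s has hs.1, ?_⟩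
      rw [Finset.mem_insert]
      exact not_or.2 ⟨hpq, fun h => hs.2 (Finset.mem_insert_of_mem h)⟩
    · exact fun s hs a ha b hb => hD s hs.1 a (hmem ha) b (hmem hb)
    · refine fun s hs h => ⟨hcone s hs.1 ?_, ?_⟩
      · simpa using ⟨hs.2, h⟩
      · simpa [hpq] using hs.2

theorem betti_points_map {K : Set (Finset α)} {L : Set (Finset β)} (e : β ↪ α)
    (h : ∀ s, s ∈ K ↔ ∃ t ∈ L, s = t.map e) (n : ℕ) : betti n (points K) = betti n (points L) := by
  classical
  let ψ : (β → ℝ) → α → ℝ := fun g => Function.extend e g 0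
  have hext (g : β → ℝ) (b : β) : ψ g (e b) = g b := e.injective.extend_apply g _ b
  have hext' (g : β → ℝ) {a : α} (ha : ¬ ∃ b, e b = a) : ψ g a = 0 :=
    Function.extend_apply' g _ a ha
  have hsum (f : α → ℝ) (hf : ∀ a, (¬ ∃ b, e b = a) → f a = 0) : ∑ b, f (e b) = ∑ a, f a := by
    rw [← Finset.sum_map Finset.univ e f]
    refine Finset.sum_subset (Finset.subset_univ _) fun a _ ha => hf a ?_
    simpa using ha
  have hzero {f : α → ℝ} (hf : f ∈ points K) (a : α) (ha : ¬ ∃ b, e b = a) : f a = 0 := by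
    obtain ⟨s, hs, hfs⟩ := hf.2.2
    obtain ⟨t, -, rfl⟩ := (h s).1 hs
    by_contra h0
    obtain ⟨b, -, hb⟩ := Finset.mem_map.1 (hfs a h0)
    exact ha ⟨b, hb⟩
  refine betti_eq_of_cohomologous (φ := fun f b => f (e b)) (ψ := ψ)
    (by fun_prop) ?_ ?_ ?_ ?_ ?_ n
  · intro f hf
    refine ⟨fun b => hf.1 _, (hsum f (hzero hf)).trans hf.2.1, ?_⟩
    obtain ⟨s, hs, hfs⟩ := hf.2.2
    obtain ⟨t, ht, rfl⟩ := (h s).1 hs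
    exact ⟨t, ht, fun b hb => by simpa using hfs _ hb⟩
  · refine continuousOn_pi.2 fun a => Continuous.continuousOn ?_
    by_cases ha : ∃ b, e b = a
    · obtain ⟨b, rfl⟩ := ha
      simpa only [hext] using continuous_apply b
    · simpa only [hext' _ ha] using continuous_const
  · intro g hg
    obtain ⟨t, ht, hgt⟩ := hg.2.2
    refine ⟨fun a => ?_, ?_, t.map e, (h _).2 ⟨t, ht, rfl⟩, fun a ha => ?_⟩
    · by_cases ha : ∃ b, e b = a
      · obtain ⟨b, rfl⟩ := ha
        rw [hext]; exact hg.1 b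
      · rw [hext' _ ha]
    · rw [← hsum _ fun a ha => hext' g ha]
      simpa only [hext] using hg.2.1
    · by_cases ha' : ∃ b, e b = a
      · obtain ⟨b, rfl⟩ := ha'
        rw [hext] at ha
        simpa using hgt b ha
      · exact absurd (hext' g ha') ha
  · refine Cohomologous.of_eqOn fun f hf => ?_
    ext a
    by_cases ha : ∃ b, e b = a
    · obtain ⟨b, rfl⟩ := ha
      exact hext (fun b => f (e b)) b
    · rw [id, hzero hf a ha]
      exact hext' (fun b => f (e b)) ha
  · refine Cohomologous.of_eqOn fun g _ => ?_
    ext b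
    exact hext g b

/-- The boundary complex of the cross-polytope with axes in `S`. -/
def crossPolytope {N : ℕ} (S : Finset (Fin N)) : Set (Finset (Fin N × Bool)) :=
  {s | ∀ i b, (i, b) ∈ s → i ∈ S ∧ (i, !b) ∉ s}

theorem betti_crossPolytope {N : ℕ} (S : Finset (Fin N)) (n : ℕ) :
    betti n (points (crossPolytope S)) = if n = S.card then 1 else 0 := by
  induction S using Finset.induction_on generalizing n with
  | empty =>
    have : points (crossPolytope (∅ : Finset (Fin N))) = ∅ := by
      refine Set.eq_empty_of_forall_notMem fun f hf => ?_
      obtain ⟨s, hs, hfs⟩ := hf.2.2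
      have h0 : ∀ a, f a = 0 := fun a => by
        by_contra h
        simpa using (hs a.1 a.2 (hfs a h)).1
      simpa [h0] using hf.2.1
    rw [this, betti_empty, Finset.card_empty]
  | insert i S hi ih =>
    have hvert (b : Bool) : {(i, b)} ∈ crossPolytope (insert i S) := by
      intro j c hj
      simp only [Finset.mem_singleton, Prod.mk.injEq] at hj
      obtain ⟨rfl, rfl⟩ := hj
      simp
    have hlink : link (crossPolytope (insert i S)) (i, true) = crossPolytope S := by
      ext s
      constructor
      · rintro ⟨h1, h2⟩ j b hj
        have h3 := h2 j b (Finset.mem_insert_of_mem hj)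
        refine ⟨(Finset.mem_insert.1 h3.1).resolve_left ?_, fun h => h3.2
          (Finset.mem_insert_of_mem h)⟩
        rintro rfl
        cases b
        · exact h3.2 (Finset.mem_insert_self _ _)
        · exact h1 hj
      · intro h
        refine ⟨fun h1 => hi (h _ _ h1).1, fun j b hj => ?_⟩
        rcases Finset.mem_insert.1 hj with hk | hk
        · obtain ⟨rfl, rfl⟩ := Prod.mk.inj hk
          refine ⟨Finset.mem_insert_self _ _, fun h1 => ?_⟩
          rcases Finset.mem_insert.1 h1 with h1 | h1
          · simp at h1
          · exact hi (h _ _ h1).1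
        · refine ⟨Finset.mem_insert_of_mem (h _ _ hk).1, fun h1 => ?_⟩
          rcases Finset.mem_insert.1 h1 with h1 | h1
          · obtain ⟨rfl, -⟩ := Prod.mk.inj h1
            exact hi (h _ _ hk).1
          · exact (h _ _ hk).2 h1
    have hcone (s : Finset (Fin N × Bool)) (hs : s ∈ crossPolytope (insert i S))
        (hit : (i, true) ∉ s) : insert (i, false) s ∈ crossPolytope (insert i S) := by
      intro j b hj
      rcases Finset.mem_insert.1 hj with hk | hk
      · obtain ⟨rfl, rfl⟩ := Prod.mk.inj hk
        refine ⟨Finset.mem_insert_self _ _, ?_⟩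
        simpa using hit
      · refine ⟨(hs _ _ hk).1, fun h1 => ?_⟩
        rcases Finset.mem_insert.1 h1 with h1 | h1
        · obtain ⟨rfl, hb⟩ := Prod.mk.inj h1
          rw [Bool.not_eq_false'] at hb
          exact hit (hb ▸ hk)
        · exact (hs _ _ hk).2 h1
    have hlow : IsLowerSet (crossPolytope (insert i S)) := fun s t hts hs j b hj =>
      ⟨(hs j b (hts hj)).1, fun h => (hs j b (hts hj)).2 (hts h)⟩
    cases n with
    | zero =>
      rw [betti_zero_eq_zero ⟨_, single_mem_points (hvert true)⟩, if_neg]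
      rw [Finset.card_insert_of_notMem hi]
      exact (Nat.succ_ne_zero _).symm
    | succ n =>
      rw [betti_points_eq_sum hlow (hvert false) {(i, true)} (by simp) (by simpa using hvert true)
        _ (by simp) (by simpa using hcone), Finset.sum_singleton, hlink, ih,
        Finset.card_insert_of_notMem hi]
      · simp
      · simp only [Finset.mem_singleton, forall_eq]
        exact fun s hs h => hcone s (hlow (Finset.subset_insert _ _) h) hs

end Realization

namespace SphereD

open Cochain Realization

/-- The linear projection of the cross-polytope coordinates to the ambient space of the sphere. -/
noncomputable def diff {d : ℕ} (f : Fin (d + 1) × Bool → ℝ) : EuclideanSpace ℝ (Fin (d + 1)) :=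
  WithLp.toLp 2 fun i => f (i, true) - f (i, false)

/-- The radial projection of Euclidean space to the cross-polytope. -/
noncomputable def parts {d : ℕ} (x : EuclideanSpace ℝ (Fin (d + 1))) (a : Fin (d + 1) × Bool) : ℝ :=
  (∑ i, |x i|)⁻¹ * max 0 (if a.2 then x a.1 else -x a.1)

theorem max_add_max_neg (y : ℝ) : max 0 y + max 0 (-y) = |y| := by
  rcases le_total 0 y with h | h
  · rw [max_eq_right h, max_eq_left (by linarith), abs_of_nonneg h, add_zero]
  · rw [max_eq_left h, max_eq_right (by linarith), abs_of_nonpos h, zero_add]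

theorem sum_abs_pos {d : ℕ} {x : EuclideanSpace ℝ (Fin (d + 1))} (hx : x ≠ 0) :
    0 < ∑ i, |x i| := by
  refine lt_of_le_of_ne (Finset.sum_nonneg fun i _ => abs_nonneg _) fun h => hx ?_
  ext i
  have := (Finset.sum_eq_zero_iff_of_nonneg fun i _ => abs_nonneg (x i)).1 h.symm i
    (Finset.mem_univ i)
  simpa using this

theorem parts_smul {d : ℕ} {c : ℝ} (hc : 0 < c) (x : EuclideanSpace ℝ (Fin (d + 1))) :
    parts (c • x) = parts x := by
  ext ⟨i, b⟩
  have h1 : ∑ i, |(c • x) i| = c * ∑ i, |x i| := by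
    simp [abs_mul, abs_of_pos hc, Finset.mul_sum]
  have h2 : max 0 (if b then (c • x) i else -(c • x) i) = c * max 0 (if b then x i else -x i) := by
    rw [mul_max_of_nonneg _ _ hc.le]
    cases b <;> simp
  simp only [parts]
  rw [h1, h2, mul_inv]
  field_simp

theorem diff_parts {d : ℕ} (x : EuclideanSpace ℝ (Fin (d + 1))) :
    diff (parts x) = (∑ i, |x i|)⁻¹ • x := by
  ext i
  simp only [diff, parts, PiLp.smul_apply, smul_eq_mul, ← mul_sub, if_true]
  congr 1
  simp only [Bool.false_eq_true, if_false]
  rcases le_total 0 (x i) with h | h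
  · rw [max_eq_right h, max_eq_left (by linarith), sub_zero]
  · rw [max_eq_left h, max_eq_right (by linarith), zero_sub, neg_neg]

theorem eq_zero_or_eq_zero {d : ℕ} {f : Fin (d + 1) × Bool → ℝ}
    (hf : f ∈ points (crossPolytope Finset.univ)) (i : Fin (d + 1)) :
    f (i, true) = 0 ∨ f (i, false) = 0 := by
  obtain ⟨s, hs, hfs⟩ := hf.2.2
  by_contra! h
  exact (hs _ _ (hfs _ h.1)).2 (hfs _ h.2)

theorem sum_abs_diff {d : ℕ} {f : Fin (d + 1) × Bool → ℝ}
    (hf : f ∈ points (crossPolytope Finset.univ)) : ∑ i, |diff f i| = 1 := by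
  rw [← hf.2.1, Fintype.sum_prod_type]
  refine Finset.sum_congr rfl fun i _ => ?_
  rw [Fintype.sum_bool]
  simp only [diff]
  have h1 := hf.1 (i, true)
  have h2 := hf.1 (i, false)
  rcases eq_zero_or_eq_zero hf i with h | h
  · rw [h, zero_sub, abs_neg, abs_of_nonneg h2, zero_add]
  · rw [h, sub_zero, abs_of_nonneg h1, add_zero]

theorem parts_diff {d : ℕ} {f : Fin (d + 1) × Bool → ℝ}
    (hf : f ∈ points (crossPolytope Finset.univ)) : parts (diff f) = f := by
  ext ⟨i, b⟩
  simp only [parts]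
  rw [sum_abs_diff hf, inv_one, one_mul]
  have h1 := hf.1 (i, true)
  have h2 := hf.1 (i, false)
  cases b <;> rcases eq_zero_or_eq_zero hf i with h | h <;> simp [diff, h, h1, h2]

theorem parts_mem {d : ℕ} {x : EuclideanSpace ℝ (Fin (d + 1))} (hx : x ≠ 0) :
    parts x ∈ points (crossPolytope Finset.univ) := by
  have hm := sum_abs_pos hx
  refine ⟨fun a => mul_nonneg (inv_nonneg.2 hm.le) (le_max_left _ _), ?_,
    Finset.univ.filter fun a => parts x a ≠ 0, fun i b hb => ⟨Finset.mem_univ i, fun hb' => ?_⟩,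
    fun a ha => by simpa using ha⟩
  · simp only [parts]
    rw [← Finset.mul_sum, Fintype.sum_prod_type]
    simp only [Fintype.sum_bool, if_true, Bool.false_eq_true, if_false, max_add_max_neg]
    exact inv_mul_cancel₀ hm.ne'
  · rw [Finset.mem_filter] at hb hb'
    have h1 := hb.2
    have h2 := hb'.2
    rcases le_total 0 (x i) with h | h <;> cases b <;> simp [parts, h] at h1 h2

/-- The cohomology of spheres. -/
theorem betti_sphere (d n : ℕ) :
    betti n (Set.univ : Set (SphereD d)) = if n = d + 1 then 1 else 0 := by
  have hne : ∀ f ∈ points (crossPolytope (Finset.univ : Finset (Fin (d + 1)))), diff f ≠ 0 := by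
    intro f hf h
    have := sum_abs_diff hf
    simp [h] at this
  have hne' : ∀ x ∈ Metric.sphere (0 : EuclideanSpace ℝ (Fin (d + 1))) 1, x ≠ 0 :=
    fun x hx h => by simp [h] at hx
  have hcont : Continuous (diff : (Fin (d + 1) × Bool → ℝ) → _) := by
    unfold diff; fun_prop
  rw [betti_subtype, ← betti_eq_of_cohomologous (S := points (crossPolytope Finset.univ))
    (φ := fun f => ‖diff f‖⁻¹ • diff f) (ψ := parts) ?_ ?_ ?_ ?_ ?_ ?_ n, betti_crossPolytope,
    Finset.card_univ, Fintype.card_fin]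
  · exact (hcont.norm.continuousOn.inv₀ fun f hf => norm_ne_zero_iff.2 (hne f hf)).smul
      hcont.continuousOn
  · intro f hf
    simp [norm_smul, hne f hf]
  · refine continuousOn_pi.2 fun a => ContinuousOn.mul (ContinuousOn.inv₀ (by fun_prop) fun x hx =>
      (sum_abs_pos (hne' x hx)).ne') ?_
    split_ifs <;> fun_prop
  · exact fun x hx => parts_mem (hne' x hx)
  · refine Cohomologous.of_eqOn fun f hf => ?_
    rw [Function.comp_apply, parts_smul (inv_pos.2 (norm_pos_iff.2 (hne f hf))), parts_diff hf, id]
  · refine Cohomologous.of_eqOn fun x hx => ?_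
    have hm := sum_abs_pos (hne' x hx)
    have h1 : ‖x‖ = 1 := by simpa using hx
    simp only [Function.comp_apply, diff_parts, norm_smul, h1, mul_one, id, smul_smul]
    rw [norm_inv, Real.norm_of_nonneg hm.le, inv_inv, mul_inv_cancel₀ hm.ne', one_smul]

end SphereD

namespace Cochain

local notation "δ" => coboundary

theorem mem_coboundaries_of_betti_eq_zero {X : Type} [TopologicalSpace X] {n : ℕ} {S : Set X}
    (h : betti n S = 0) {f : Cochain X} (hf : f ∈ cocycles n S) : f ∈ coboundaries S := by
  have := rank_zero_iff.1 h
  exact (mk_eq_zero_iff (⟨f, hf⟩ : cocycles n S)).1 (Subsingleton.elim _ _)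

/-- The number of spheres in a wedge of spheres is a homotopy invariant. -/
theorem betti_of_homotopyEquiv_wedge {X : Type} [PseudoMetricSpace X] [CompactSpace X] {c : ℕ → ℕ}
    (e : ContinuousMap.HomotopyEquiv X (WedgeOfSpheresCounted c)) (d : ℕ) :
    betti (d + 1) (Set.univ : Set X) = c d := by
  classical
  let inc (i : Σ d : ℕ, Fin (c d)) : C(SphereD i.1, WedgeOfSpheresCounted c) :=
    .mk (PWedge.incl
      (P := fun i : Σ d : ℕ, Fin (c d) => SphereD i.1) (pt := fun i => SphereD.pt i.1) i)
      (PWedge.continuous_incl i)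
  let pr (i : Σ d : ℕ, Fin (c d)) : C(WedgeOfSpheresCounted c, SphereD i.1) :=
    .mk (PWedge.proj
      (P := fun i : Σ d : ℕ, Fin (c d) => SphereD i.1) (pt := fun i => SphereD.pt i.1) i)
      (PWedge.continuous_proj i)
  let γ (j : Fin (c d)) : C(SphereD d, X) := e.invFun.comp (inc ⟨d, j⟩)
  have univ_maps {A B : Type} (φ : A → B) : Set.MapsTo φ Set.univ Set.univ := Set.mapsTo_univ _ _
  let Θ : Cohomology (d + 1) (Set.univ : Set X) →ₗ[ZMod 2]
      (Fin (c d) → Cohomology (d + 1) (Set.univ : Set (SphereD d))) :=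
    LinearMap.pi fun j => cohomologyMap (pull (γ j))
      (fun f hf => pull_mem_cocycles (γ j).continuous.continuousOn (univ_maps _) hf)
      (fun f _ hf => pull_mem_coboundaries (γ j).continuous.continuousOn (univ_maps _) hf)
  have hinj : Function.Injective Θ := by
    rw [← LinearMap.ker_eq_bot, LinearMap.ker_eq_bot']
    intro a ha
    obtain ⟨f, rfl⟩ := Submodule.Quotient.mk_surjective _ a
    rw [mk_eq_zero_iff]
    have hfγ (j : Fin (c d)) : pull (γ j) f.1 ∈ coboundaries Set.univ :=
      (mk_eq_zero_iff _).1 (congrFun ha j)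
    choose s hs hs0 N hN hpt hs1 using SphereD.exists_squash
    have hF : pull e.invFun f.1 ∈ cocycles (d + 1) Set.univ :=
      pull_mem_cocycles e.invFun.continuous.continuousOn (univ_maps _) f.2
    have hφ := PWedge.pull_mem_coboundaries_of_incl (fun i : Σ d : ℕ, Fin (c d) => s i.1)
      (fun i => hs i.1) (fun i => hs0 i.1) (fun i => N i.1) (fun i => hN i.1) (fun i => hpt i.1)
      (fun i => hs1 i.1) hF.2 ?_ e.toFun
    · rw [pull_pull] at hφ
      have h1 := (e.left_inv.some).cohomologous f.1 f.2.2
      have h2 : pull (fun x => e.invFun (e.toFun x)) f.1 -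
          (pull (fun x => e.invFun (e.toFun x)) f.1 - pull id f.1) ∈ coboundaries Set.univ :=
        sub_mem hφ h1
      rwa [sub_sub_cancel, pull_id] at h2
    · rintro ⟨d', j⟩
      by_cases hd : d' = d
      · subst hd
        rw [pull_pull]
        exact hfγ j
      · refine mem_coboundaries_of_betti_eq_zero (n := d + 1) ?_
          (pull_mem_cocycles (inc ⟨d', j⟩).continuous.continuousOn (univ_maps _) hF)
        rw [SphereD.betti_sphere, if_neg]
        exact fun h => hd (Nat.succ_injective h).symm
  have hsurj : Function.Surjective Θ := by
    intro y
    choose σ hσ using fun j => Submodule.Quotient.mk_surjective _ (y j)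
    have hF : ∑ i, pull (pr ⟨d, i⟩) (σ i).1 ∈ cocycles (d + 1) Set.univ :=
      sum_mem fun i _ => pull_mem_cocycles (pr ⟨d, i⟩).continuous.continuousOn (univ_maps _) (σ i).2
    refine ⟨Submodule.Quotient.mk ⟨pull e.toFun (∑ i, pull (pr ⟨d, i⟩) (σ i).1),
      pull_mem_cocycles e.toFun.continuous.continuousOn (univ_maps _) hF⟩, ?_⟩
    ext j
    rw [← hσ]
    refine (Submodule.Quotient.eq _).2 ?_
    change pull (γ j) (pull e.toFun (∑ i, pull (pr ⟨d, i⟩) (σ i).1)) - (σ j).1 ∈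
      coboundaries Set.univ
    have h1 : ((e.toFun.comp e.invFun).comp (inc ⟨d, j⟩)).Homotopic
        ((ContinuousMap.id _).comp (inc ⟨d, j⟩)) :=
      e.right_inv.comp (ContinuousMap.Homotopic.refl _)
    have h2 := h1.some.cohomologous _ hF.2
    have h3 : pull (inc ⟨d, j⟩) (∑ i, pull (pr ⟨d, i⟩) (σ i).1) - (σ j).1 ∈
        coboundaries Set.univ := by
      have h4 : pull (inc ⟨d, j⟩) (pull (pr ⟨d, j⟩) (σ j).1) = (σ j).1 := by
        rw [pull_pull, show (fun x => pr ⟨d, j⟩ (inc ⟨d, j⟩ x)) = id from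
          funext fun x => PWedge.proj_incl (P := fun i : Σ d : ℕ, Fin (c d) => SphereD i.1)
            (pt := fun i => SphereD.pt i.1) ⟨d, j⟩ x, pull_id]
      rw [map_sum, ← Finset.add_sum_erase _ _ (Finset.mem_univ j), h4, add_sub_cancel_left]
      refine sum_mem fun i hi => ?_
      have hne : (⟨d, j⟩ : Σ d : ℕ, Fin (c d)) ≠ ⟨d, i⟩ := by
        simpa [eq_comm] using (Finset.mem_erase.1 hi).1
      rw [pull_pull, show (fun x => pr ⟨d, i⟩ (inc ⟨d, j⟩ x)) = fun _ => SphereD.pt d from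
        funext fun x => PWedge.proj_incl_of_ne (P := fun i : Σ d : ℕ, Fin (c d) => SphereD i.1)
            (pt := fun i => SphereD.pt i.1) hne x]
      exact pull_const_mem (Set.mem_univ _) (σ i).2.2
    rw [pull_pull, ← sub_add_sub_cancel _ (pull (inc ⟨d, j⟩) (∑ i, pull (pr ⟨d, i⟩) (σ i).1))]
    exact add_mem h2 h3
  have h := (LinearEquiv.ofBijective Θ ⟨hinj, hsurj⟩).rank_eq
  have h1 := SphereD.betti_sphere d (d + 1)
  rw [if_pos rfl] at h1
  rw [betti, h, rank_fun, ← betti, h1, Fintype.card_fin, mul_one]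

end Cochain

namespace Realization

open Cochain

section Subtype

variable {α : Type} [Fintype α]

theorem mem_points_iff {K : Set (Finset α)} {f : α → ℝ} : f ∈ points K ↔
    (∀ a, 0 ≤ f a) ∧ ∃ s ∈ K, (∀ a, f a ≠ 0 → a ∈ s) ∧ ∑ a ∈ s, f a = 1 := by
  have key (s : Finset α) (h : ∀ a, f a ≠ 0 → a ∈ s) : ∑ a ∈ s, f a = ∑ a, f a :=
    Finset.sum_subset (Finset.subset_univ s) fun a _ ha => not_not.1 (mt (h a) ha)
  refine and_congr_right fun _ => ⟨?_, ?_⟩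
  · rintro ⟨h1, s, hs, h⟩
    exact ⟨s, hs, h, (key s h).trans h1⟩
  · rintro ⟨s, hs, h, h1⟩
    exact ⟨(key s h).symm.trans h1, s, hs, h⟩

theorem betti_points_of_homotopyEquiv_wedge {K : Set (Finset α)} {c : ℕ → ℕ}
    (e : ContinuousMap.HomotopyEquiv (Realization K) (WedgeOfSpheresCounted c)) (d : ℕ) :
    betti (d + 1) (points K) = c d := by
  have h : points K = {f : α → ℝ | (∀ a, 0 ≤ f a) ∧
      ∃ s ∈ K, (∀ a, f a ≠ 0 → a ∈ s) ∧ ∑ a ∈ s, f a = 1} := Set.ext fun _ => mem_points_iff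
  have hc := isCompact_points K
  rw [h] at hc
  have : CompactSpace (Realization K) := isCompact_iff_compactSpace.1 hc
  rw [← betti_of_homotopyEquiv_wedge e d, h]
  exact (betti_subtype _ _).symm

end Subtype

end Realization

section MatchingComplex

open Cochain Realization

variable {V W : Type} {G : SimpleGraph V}

theorem isLowerSet_matchingComplex : IsLowerSet (matchingComplex G) := fun _ _ hst hs =>
  ⟨fun e he => hs.1 e (hst he), hs.2.mono (Finset.coe_subset.2 hst)⟩

theorem singleton_mem_matchingComplex {e : Sym2 V} (he : e ∈ G.edgeSet) :
    {e} ∈ matchingComplex G := by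
  simp [matchingComplex, he]

theorem eq_of_mem_matchingComplex {s : Finset (Sym2 V)} (hs : s ∈ matchingComplex G) {v : V}
    {e f : Sym2 V} (he : e ∈ s) (hf : f ∈ s) (hve : v ∈ e) (hvf : v ∈ f) : e = f :=
  by_contra fun hne => hs.2 he hf hne ⟨v, hve, hvf⟩

theorem insert_mem_matchingComplex [DecidableEq V] {s : Finset (Sym2 V)} {v w : V}
    (hvw : G.Adj v w) (hs : s ∈ matchingComplex G) (h : ∀ e ∈ s, v ∉ e ∧ w ∉ e) :
    insert s(v, w) s ∈ matchingComplex G := by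
  refine ⟨fun e he => ?_, ?_⟩
  · rcases Finset.mem_insert.1 he with rfl | he
    · exact hvw
    · exact hs.1 e he
  · rw [Finset.coe_insert, Set.pairwise_insert]
    refine ⟨hs.2, fun e he _ => ⟨?_, ?_⟩⟩
    · rintro ⟨u, hu, hue⟩
      rcases Sym2.mem_iff.1 hu with rfl | rfl
      exacts [(h e he).1 hue, (h e he).2 hue]
    · rintro ⟨u, hue, hu⟩
      rcases Sym2.mem_iff.1 hu with rfl | rfl
      exacts [(h e he).1 hue, (h e he).2 hue]

theorem mem_link_matchingComplex [DecidableEq V] {s : Finset (Sym2 V)} {v w : V}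
    (hvw : G.Adj v w) : s ∈ link (matchingComplex G) s(v, w) ↔
      s ∈ matchingComplex G ∧ ∀ e ∈ s, v ∉ e ∧ w ∉ e := by
  refine ⟨fun ⟨h1, h2⟩ => ⟨isLowerSet_matchingComplex (Finset.subset_insert _ _) h2,
    fun e he => ⟨fun hv => h1 ?_, fun hw => h1 ?_⟩⟩, fun ⟨hs, h⟩ => ⟨fun h1 => (h _ h1).1 (by simp),
    insert_mem_matchingComplex hvw hs h⟩⟩
  · exact eq_of_mem_matchingComplex h2 (Finset.mem_insert_of_mem he) (Finset.mem_insert_self _ _)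
      hv (by simp) ▸ he
  · exact eq_of_mem_matchingComplex h2 (Finset.mem_insert_of_mem he) (Finset.mem_insert_self _ _)
      hw (by simp) ▸ he

variable [Fintype V] [DecidableEq V]

/-- The cohomology of the matching complex of a graph with a leaf `l` attached to `v` is determined
by the links of the other edges at `v`. -/
theorem betti_matchingComplex_of_leaf {v l : V} (hvl : G.Adj v l) (hl : ∀ w, G.Adj l w → w = v)
    (N : Finset V) (hN : ∀ w, w ∈ N ↔ G.Adj v w ∧ w ≠ l) (n : ℕ) :
    betti (n + 1) (points (matchingComplex G)) =
      ∑ w ∈ N, betti n (points (link (matchingComplex G) s(v, w))) := by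
  have hedge {e : Sym2 V} (he : e ∈ G.edgeSet) (hle : l ∈ e) : v ∈ e := by
    obtain ⟨w, rfl⟩ := Sym2.mem_iff_exists.1 hle
    rw [hl w he]
    simp
  rw [betti_points_eq_sum isLowerSet_matchingComplex (q := s(v, l))
    (singleton_mem_matchingComplex hvl) (N.image fun w => s(v, w)), Finset.sum_image]
  · exact fun a _ b _ h => Sym2.congr_right.1 h
  · intro h
    obtain ⟨w, hw, h⟩ := Finset.mem_image.1 h
    exact ((hN w).1 hw).2 (Sym2.congr_right.1 h)
  · intro p hp
    obtain ⟨w, hw, rfl⟩ := Finset.mem_image.1 hp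
    exact singleton_mem_matchingComplex ((hN w).1 hw).1
  · intro p hp s hps hs
    obtain ⟨w, hw, rfl⟩ := Finset.mem_image.1 hp
    obtain ⟨hs, h⟩ := (mem_link_matchingComplex ((hN w).1 hw).1).1 ⟨hps, hs⟩
    exact insert_mem_matchingComplex hvl hs
      fun e he => ⟨(h e he).1, fun hle => (h e he).1 (hedge (hs.1 e he) hle)⟩
  · intro s hs a ha b hb has hbs
    obtain ⟨w, -, rfl⟩ := Finset.mem_image.1 ha
    obtain ⟨w', -, rfl⟩ := Finset.mem_image.1 hb
    exact eq_of_mem_matchingComplex hs (v := v) has hbs (by simp) (by simp)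
  · intro s hs h
    by_cases hq : s(v, l) ∈ s
    · rwa [Finset.insert_eq_of_mem hq]
    · have hv (e : Sym2 V) (he : e ∈ s) (hve : v ∈ e) : False := by
        obtain ⟨w, rfl⟩ := Sym2.mem_iff_exists.1 hve
        by_cases hw : w = l
        · exact hq (hw ▸ he)
        · exact h _ (Finset.mem_image_of_mem _ ((hN w).2 ⟨hs.1 _ he, hw⟩)) he
      exact insert_mem_matchingComplex hvl hs
        fun e he => ⟨hv e he, fun hle => hv e he (hedge (hs.1 e he) hle)⟩

/-- The link of an edge of the matching complex is the matching complex of the graph obtained by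
removing its endpoints, up to isolated vertices. -/
theorem betti_link_matchingComplex [Fintype W] {H : SimpleGraph W} {v w : V} (hvw : G.Adj v w)
    (f : W ↪ V) (hf : ∀ x y, (G.Adj x y ∧ v ≠ x ∧ w ≠ x ∧ v ≠ y ∧ w ≠ y) ↔
      ∃ a b, H.Adj a b ∧ f a = x ∧ f b = y) (n : ℕ) :
    betti n (points (link (matchingComplex G) s(v, w))) = betti n (points (matchingComplex H)) := by
  classical
  have hinc (e e' : Sym2 W) :
      EdgeIncident (f.sym2Map e) (f.sym2Map e') ↔ EdgeIncident e e' := by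
    constructor
    · rintro ⟨x, hx, hx'⟩
      obtain ⟨a, ha, rfl⟩ := Sym2.mem_map.1 hx
      obtain ⟨b, hb, hab⟩ := Sym2.mem_map.1 hx'
      exact ⟨a, ha, f.injective hab ▸ hb⟩
    · rintro ⟨a, ha, ha'⟩
      exact ⟨f a, Sym2.mem_map.2 ⟨a, ha, rfl⟩, Sym2.mem_map.2 ⟨a, ha', rfl⟩⟩
  have hedge (e : Sym2 V) : (e ∈ G.edgeSet ∧ v ∉ e ∧ w ∉ e) ↔
      ∃ e' ∈ H.edgeSet, f.sym2Map e' = e := by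
    induction e with
    | _ x y =>
      constructor
      · rintro ⟨h1, h2, h3⟩
        obtain ⟨a, b, h, rfl, rfl⟩ := (hf x y).1 ⟨h1, by simp_all⟩
        exact ⟨s(a, b), h, rfl⟩
      · rintro ⟨e', h, he⟩
        induction e' with
        | _ a b =>
          have := (hf (f a) (f b)).2 ⟨a, b, h, rfl, rfl⟩
          rw [← he]
          simpa [and_assoc, and_comm, and_left_comm] using this
  refine betti_points_map f.sym2Map (fun s => ?_) n
  rw [mem_link_matchingComplex hvw]
  constructor
  · rintro ⟨hs, h⟩
    refine ⟨s.preimage f.sym2Map f.sym2Map.injective.injOn, ⟨fun e he => ?_, ?_⟩, ?_⟩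
    · obtain ⟨e', he', h'⟩ := (hedge _).1 ⟨hs.1 _ (Finset.mem_preimage.1 he),
        h _ (Finset.mem_preimage.1 he)⟩
      exact f.sym2Map.injective h' ▸ he'
    · intro e he e' he' hne
      rw [← hinc]
      exact hs.2 (Finset.mem_preimage.1 he) (Finset.mem_preimage.1 he') (f.sym2Map.injective.ne hne)
    · ext e
      simp only [Finset.mem_map, Finset.mem_preimage]
      refine ⟨fun he => ?_, ?_⟩
      · obtain ⟨e', -, rfl⟩ := (hedge e).1 ⟨hs.1 e he, h e he⟩
        exact ⟨e', he, rfl⟩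
      · rintro ⟨e', he', rfl⟩
        exact he'
  · rintro ⟨t, ht, rfl⟩
    have key (e : Sym2 V) (he : e ∈ t.map f.sym2Map) : e ∈ G.edgeSet ∧ v ∉ e ∧ w ∉ e := by
      obtain ⟨e', he', rfl⟩ := Finset.mem_map.1 he
      exact (hedge _).2 ⟨e', ht.1 e' he', rfl⟩
    refine ⟨⟨fun e he => (key e he).1, ?_⟩, fun e he => (key e he).2⟩
    rw [Finset.coe_map, f.sym2Map.injective.injOn.pairwise_image]
    intro e he e' he' hne
    exact mt (hinc e e').1 (ht.2 he he' hne)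

end MatchingComplex

section Caterpillar

open Cochain Realization

variable {n : ℕ} {m : Fin n → ℕ}

theorem caterpillar_adj_inl_inl {i j : Fin n} :
    (caterpillar n m).Adj (Sum.inl i) (Sum.inl j) ↔ (i : ℕ) + 1 = j ∨ (j : ℕ) + 1 = i := by
  simp only [caterpillar, SimpleGraph.fromRel_adj, ne_eq, Sum.inl.injEq, and_iff_right_iff_imp]
  rintro h rfl
  omega

theorem caterpillar_adj_inl_inr {i : Fin n} {x : Σ i : Fin n, Fin (m i)} :
    (caterpillar n m).Adj (Sum.inl i) (Sum.inr x) ↔ i = x.1 := by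
  simp [caterpillar]

theorem caterpillar_adj_inr_inl {i : Fin n} {x : Σ i : Fin n, Fin (m i)} :
    (caterpillar n m).Adj (Sum.inr x) (Sum.inl i) ↔ i = x.1 := by
  rw [SimpleGraph.adj_comm, caterpillar_adj_inl_inr]

theorem caterpillar_adj_inr_inr {x y : Σ i : Fin n, Fin (m i)} :
    ¬ (caterpillar n m).Adj (Sum.inr x) (Sum.inr y) := by
  simp [caterpillar]

/-- The position along the path of a vertex of a caterpillar. -/
def caterpillarPos : (Fin n ⊕ Σ i : Fin n, Fin (m i)) → ℕ :=
  Sum.elim (fun i => i) fun x => x.1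

/-- The inclusion of the caterpillar on the first `k` path vertices. -/
def caterpillarInclusion {k n : ℕ} (m : ℕ → ℕ) (h : k ≤ n) :
    (Fin k ⊕ Σ i : Fin k, Fin (m i)) ↪ (Fin n ⊕ Σ i : Fin n, Fin (m i)) where
  toFun := Sum.map (Fin.castLE h) fun x => ⟨Fin.castLE h x.1, x.2⟩
  inj' := (Fin.castLE_injective h).sumMap (by rintro ⟨i, x⟩ ⟨j, y⟩ hxy; simp_all)

theorem caterpillarInclusion_adj {k n : ℕ} {m : ℕ → ℕ} (h : k ≤ n)
    {x y : Fin k ⊕ Σ i : Fin k, Fin (m i)} :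
    (caterpillar n fun i => m i).Adj (caterpillarInclusion m h x) (caterpillarInclusion m h y) ↔
      (caterpillar k fun i => m i).Adj x y := by
  rcases x with i | x <;> rcases y with j | y <;>
    simp [caterpillarInclusion, caterpillar_adj_inl_inl, caterpillar_adj_inl_inr,
      caterpillar_adj_inr_inl, caterpillar_adj_inr_inr]

theorem caterpillarPos_lt_iff {k n : ℕ} {m : ℕ → ℕ} (h : k ≤ n)
    {x : Fin n ⊕ Σ i : Fin n, Fin (m i)} :
    caterpillarPos x < k ↔ ∃ y, caterpillarInclusion m h y = x := by
  constructor
  · rcases x with i | ⟨i, x⟩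
    · exact fun hi => ⟨Sum.inl ⟨i, hi⟩, rfl⟩
    · exact fun hi => ⟨Sum.inr ⟨⟨i, hi⟩, x⟩, rfl⟩
  · rintro ⟨i | ⟨i, x⟩, rfl⟩
    exacts [i.2, i.2]

/-- Removing the endpoints of an edge may leave, up to isolated vertices, the caterpillar on the
first `k` path vertices. -/
theorem betti_link_caterpillar {k n : ℕ} {m : ℕ → ℕ} (h : k ≤ n)
    {v w : Fin n ⊕ Σ i : Fin n, Fin (m i)} (hvw : (caterpillar n fun i => m i).Adj v w)
    (hv : k ≤ caterpillarPos v) (hw : k ≤ caterpillarPos w)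
    (hk : ∀ x y, (caterpillar n fun i => m i).Adj x y → k ≤ caterpillarPos x →
      v = x ∨ w = x ∨ v = y ∨ w = y) (d : ℕ) :
    betti d (points (link (matchingComplex (caterpillar n fun i => m i)) s(v, w))) =
      betti d (points (matchingComplex (caterpillar k fun i => m i))) := by
  refine betti_link_matchingComplex hvw (caterpillarInclusion m h) (fun x y => ⟨?_, ?_⟩) d
  · rintro ⟨hxy, h1, h2, h3, h4⟩
    obtain ⟨a, rfl⟩ := (caterpillarPos_lt_iff h).1 (not_le.1 fun hx => by
      rcases hk x y hxy hx with h | h | h | h <;> contradiction)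
    obtain ⟨b, rfl⟩ := (caterpillarPos_lt_iff h).1 (not_le.1 fun hy => by
      rcases hk y _ hxy.symm hy with h | h | h | h <;> contradiction)
    exact ⟨a, b, (caterpillarInclusion_adj h).1 hxy, rfl, rfl⟩
  · rintro ⟨a, b, hab, rfl, rfl⟩
    have key {u : Fin n ⊕ Σ i : Fin n, Fin (m i)} (hu : k ≤ caterpillarPos u)
        (z : Fin k ⊕ Σ i : Fin k, Fin (m i)) : u ≠ caterpillarInclusion m h z := by
      rintro rfl
      exact hu.not_gt ((caterpillarPos_lt_iff h).2 ⟨z, rfl⟩)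
    exact ⟨(caterpillarInclusion_adj h).2 hab, key hv a, key hw a, key hv b, key hw b⟩

/-- The Betti numbers of the matching complex of the caterpillar on the first `k` path vertices. -/
noncomputable def caterpillarBetti (m : ℕ → ℕ) (k d : ℕ) : Cardinal :=
  betti d (points (matchingComplex (caterpillar k fun i : Fin k => m i)))

theorem caterpillarBetti_zero {m : ℕ → ℕ} (hm : 1 ≤ m 0) {k : ℕ} (hk : 1 ≤ k) :
    caterpillarBetti m k 0 = 0 := by
  have h : (caterpillar k fun i : Fin k => m i).Adj (Sum.inl ⟨0, hk⟩)
      (Sum.inr ⟨⟨0, hk⟩, ⟨0, hm⟩⟩) := caterpillar_adj_inl_inr.2 rfl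
  exact betti_zero_eq_zero ⟨_, single_mem_points (singleton_mem_matchingComplex
    ((SimpleGraph.mem_edgeSet _).2 h))⟩

theorem caterpillarBetti_of_leg {m : ℕ → ℕ} {q : ℕ} (hm : 1 ≤ m (q + 1)) (d : ℕ) :
    caterpillarBetti m (q + 2) (d + 1) =
      (m (q + 1) - 1 : ℕ) * caterpillarBetti m (q + 1) d + caterpillarBetti m q d := by
  let a : Fin (q + 2) := ⟨q + 1, by omega⟩
  let b : Fin (q + 2) := ⟨q, by omega⟩
  let l : Fin (m a) := ⟨0, hm⟩
  have hab (i : Fin (q + 2)) (hi : q ≤ i) : i = a ∨ i = b := by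
    simp only [a, b, Fin.ext_iff]; omega
  have hleg (j : Fin (m a)) : betti d (points (link (matchingComplex
      (caterpillar (q + 2) fun i => m i)) s(Sum.inl a, Sum.inr ⟨a, j⟩))) =
      caterpillarBetti m (q + 1) d := by
    refine betti_link_caterpillar (k := q + 1) (n := q + 2) (m := m) (v := Sum.inl a)
      (w := Sum.inr ⟨a, j⟩) (by omega) (caterpillar_adj_inl_inr.2 rfl) (le_refl (q + 1))
      (le_refl (q + 1)) ?_ d
    have ha (i : Fin (q + 2)) (hi : q + 1 ≤ i) : i = a := by
      simp only [a, Fin.ext_iff]; omega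
    rintro (i | x) (y | y) h hx
    · simp [ha i hx]
    · simp [ha i hx]
    · simp [caterpillar_adj_inr_inl.1 h, ha x.1 hx]
    · exact absurd h caterpillar_adj_inr_inr
  have hpath : betti d (points (link (matchingComplex
      (caterpillar (q + 2) fun i => m i)) s(Sum.inl a, Sum.inl b))) =
      caterpillarBetti m q d := by
    refine betti_link_caterpillar (k := q) (n := q + 2) (m := m) (v := Sum.inl a)
      (w := Sum.inl b) (by omega) (caterpillar_adj_inl_inl.2 (Or.inr rfl)) q.le_succ
      (le_refl q) ?_ d
    rintro (i | x) (y | y) h hx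
    · rcases hab i hx with rfl | rfl <;> simp
    · rcases hab i hx with rfl | rfl <;> simp
    · rcases hab x.1 hx with h' | h' <;> simp [caterpillar_adj_inr_inl.1 h, h']
    · exact absurd h caterpillar_adj_inr_inr
  rw [caterpillarBetti, betti_matchingComplex_of_leaf (v := Sum.inl a) (l := Sum.inr ⟨a, l⟩)
    (caterpillar_adj_inl_inr.2 rfl) ?_
    (Finset.disjSum {b} ((Finset.univ.erase l).map (Function.Embedding.sigmaMk a))) ?_,
    Finset.sum_disjSum, Finset.sum_singleton, Finset.sum_map, add_comm]
  · simp only [Function.Embedding.sigmaMk_apply]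
    rw [hpath, Finset.sum_congr rfl fun j _ => hleg j, Finset.sum_const,
      Finset.card_erase_of_mem (Finset.mem_univ l), Finset.card_univ, Fintype.card_fin,
      nsmul_eq_mul]
  · rintro (i | x) h
    · rw [caterpillar_adj_inr_inl.1 h]
    · exact absurd h caterpillar_adj_inr_inr
  · rintro (i | ⟨i, x⟩)
    · simp only [Finset.inl_mem_disjSum, Finset.mem_singleton, caterpillar_adj_inl_inl, ne_eq,
        reduceCtorEq, not_false_eq_true, and_true, a, b, Fin.ext_iff]
      omega
    · simp only [Finset.inr_mem_disjSum, Finset.mem_map, Finset.mem_erase, Finset.mem_univ,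
        and_true, caterpillar_adj_inl_inr, Function.Embedding.sigmaMk_apply, ne_eq, Sum.inr.injEq]
      constructor
      · rintro ⟨j, hj, h⟩
        cases h
        exact ⟨rfl, by simpa using hj⟩
      · rintro ⟨rfl, h⟩
        exact ⟨x, by simpa using h, rfl⟩

theorem caterpillarBetti_of_eq_zero {m : ℕ → ℕ} {q : ℕ} (hm : m (q + 2) = 0) (d : ℕ) :
    caterpillarBetti m (q + 3) (d + 1) =
      m (q + 1) * caterpillarBetti m (q + 1) d + caterpillarBetti m q d := by
  let a : Fin (q + 3) := ⟨q + 1, by omega⟩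
  let b : Fin (q + 3) := ⟨q, by omega⟩
  let l : Fin (q + 3) := ⟨q + 2, by omega⟩
  have hal (i : Fin (q + 3)) (hi : q + 1 ≤ i) : i = a ∨ i = l := by
    simp only [a, l, Fin.ext_iff]; omega
  have habl (i : Fin (q + 3)) (hi : q ≤ i) : i = a ∨ i = b ∨ i = l := by
    simp only [a, b, l, Fin.ext_iff]; omega
  have hl (y : Fin (q + 3) ⊕ Σ i : Fin (q + 3), Fin (m i))
      (h : (caterpillar (q + 3) fun i => m i).Adj (Sum.inl l) y) : y = Sum.inl a := by
    rcases y with i | ⟨i, x⟩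
    · have := caterpillar_adj_inl_inl.1 h
      have := i.2
      simp only [Sum.inl.injEq, a, l, Fin.ext_iff] at *
      omega
    · obtain rfl := caterpillar_adj_inl_inr.1 h
      exact absurd x.2 (by simp [l, hm])
  have hleg_pos (x : Σ i : Fin (q + 3), Fin (m i)) : x.1 ≠ l := fun h => by
    have := hl (Sum.inr x) (caterpillar_adj_inl_inr.2 h.symm)
    simp at this
  have hleg (j : Fin (m a)) : betti d (points (link (matchingComplex
      (caterpillar (q + 3) fun i => m i)) s(Sum.inl a, Sum.inr ⟨a, j⟩))) =
      caterpillarBetti m (q + 1) d := by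
    refine betti_link_caterpillar (k := q + 1) (n := q + 3) (m := m) (v := Sum.inl a)
      (w := Sum.inr ⟨a, j⟩) (by omega) (caterpillar_adj_inl_inr.2 rfl) (le_refl (q + 1))
      (le_refl (q + 1)) ?_ d
    rintro (i | x) (y | y) h hx
    · rcases hal i hx with rfl | rfl
      · simp
      · simp [hl _ h]
    · rcases hal i hx with rfl | rfl
      · simp
      · simp [hl _ h]
    · simp [caterpillar_adj_inr_inl.1 h, (hal x.1 hx).resolve_right (hleg_pos x)]
    · exact absurd h caterpillar_adj_inr_inr
  have hpath : betti d (points (link (matchingComplex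
      (caterpillar (q + 3) fun i => m i)) s(Sum.inl a, Sum.inl b))) =
      caterpillarBetti m q d := by
    refine betti_link_caterpillar (k := q) (n := q + 3) (m := m) (v := Sum.inl a)
      (w := Sum.inl b) (by omega) (caterpillar_adj_inl_inl.2 (Or.inr rfl)) q.le_succ
      (le_refl q) ?_ d
    rintro (i | x) (y | y) h hx
    · rcases habl i hx with rfl | rfl | rfl
      · simp
      · simp
      · simp [hl _ h]
    · rcases habl i hx with rfl | rfl | rfl
      · simp
      · simp
      · simp [hl _ h]
    · rcases habl x.1 hx with h' | h' | h'
      · simp [caterpillar_adj_inr_inl.1 h, h']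
      · simp [caterpillar_adj_inr_inl.1 h, h']
      · exact absurd h' (hleg_pos x)
    · exact absurd h caterpillar_adj_inr_inr
  rw [caterpillarBetti, betti_matchingComplex_of_leaf (v := Sum.inl a) (l := Sum.inl l)
    (caterpillar_adj_inl_inl.2 (Or.inl rfl)) hl
    (Finset.disjSum {b} (Finset.univ.map (Function.Embedding.sigmaMk a))) ?_,
    Finset.sum_disjSum, Finset.sum_singleton, Finset.sum_map, add_comm]
  · simp only [Function.Embedding.sigmaMk_apply]
    rw [hpath, Finset.sum_congr rfl fun j _ => hleg j, Finset.sum_const,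
      Finset.card_univ, Fintype.card_fin, nsmul_eq_mul]
  · rintro (i | ⟨i, x⟩)
    · have := i.2
      simp only [Finset.inl_mem_disjSum, Finset.mem_singleton, caterpillar_adj_inl_inl, ne_eq,
        Sum.inl.injEq, a, b, l, Fin.ext_iff]
      omega
    · simp only [Finset.inr_mem_disjSum, Finset.mem_map, Finset.mem_univ, true_and,
        caterpillar_adj_inl_inr, Function.Embedding.sigmaMk_apply, ne_eq, reduceCtorEq,
        not_false_eq_true, and_true]
      constructor
      · rintro ⟨j, h⟩
        cases h
        rfl
      · rintro rfl
        exact ⟨x, rfl⟩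

end Caterpillar

/-- Let `m : ℕ → ℕ` give the numbers of legs (`m 0` is the number of
legs at the first path vertex, so `m (i-1)` is `m_i`), with `m₁ ≥ 1`, and let
`A k d` denote the number of `d`-dimensional spheres in the wedge-of-spheres
decomposition of the matching complex of the caterpillar on the first `k` path
vertices. Then for `n ≥ 3` the counts for the caterpillar on `n+1` path vertices
satisfy (with the convention `A_{k,−1} = 0`):
`A_{n+1,d} = t_{n+1}A_{n,d−1} + A_{n−1,d−1}` if `m_{n+1} ≥ 1`;
`A_{n+1,d} = A_{n,d} + A_{n−1,d−1}` if `m_{n+1} = 0` and `m_n ≥ 1`;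
`A_{n+1,d} = A_{n−2,d−1}` if `m_{n+1} = m_n = 0`. -/
theorem caterpillar_sphere_count_recursion (n : ℕ) (hn : 3 ≤ n) (m : ℕ → ℕ)
    (hm1 : 1 ≤ m 0) (A : ℕ → ℕ → ℕ)
    (hA : ∀ k, 1 ≤ k → k ≤ n + 1 →
      Nonempty
        (ContinuousMap.HomotopyEquiv
          (Realization (matchingComplex (caterpillar k (fun i : Fin k => m (i : ℕ)))))
          (WedgeOfSpheresCounted (A k)))) :
    (1 ≤ m n →
      (∀ d : ℕ, A (n + 1) (d + 1) = (m n - 1) * A n d + A (n - 1) d) ∧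
        A (n + 1) 0 = 0) ∧
    (m n = 0 → 1 ≤ m (n - 1) →
      (∀ d : ℕ, A (n + 1) (d + 1) = A n (d + 1) + A (n - 1) d) ∧
        A (n + 1) 0 = A n 0) ∧
    (m n = 0 → m (n - 1) = 0 →
      (∀ d : ℕ, A (n + 1) (d + 1) = A (n - 2) d) ∧ A (n + 1) 0 = 0) := by
  have hB (k d : ℕ) (hk : 1 ≤ k) (hkn : k ≤ n + 1) : caterpillarBetti m k (d + 1) = A k d :=
    Realization.betti_points_of_homotopyEquiv_wedge (hA k hk hkn).some d
  have h0 (k : ℕ) (hk : 1 ≤ k) := caterpillarBetti_zero hm1 hk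
  obtain ⟨q, rfl⟩ : ∃ q, n = q + 3 := ⟨n - 3, by omega⟩
  simp only [show q + 3 - 1 = q + 2 by omega, show q + 3 - 2 = q + 1 by omega]
  have hleg (k : ℕ) (hk : k ≤ q + 2) (hk1 : 1 ≤ k) (h : 1 ≤ m (k + 1)) :
      (∀ d, A (k + 2) (d + 1) = (m (k + 1) - 1) * A (k + 1) d + A k d) ∧ A (k + 2) 0 = 0 := by
    refine ⟨fun d => ?_, ?_⟩
    · have := caterpillarBetti_of_leg h (d + 1)
      rw [hB _ _ (by omega) (by omega), hB _ _ (by omega) (by omega),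
        hB _ _ (by omega) (by omega)] at this
      exact_mod_cast this
    · have := caterpillarBetti_of_leg h 0
      rw [hB _ _ (by omega) (by omega), h0 _ (by omega), h0 _ hk1] at this
      simpa using this
  have hzero (h : m (q + 3) = 0) :
      (∀ d, A (q + 4) (d + 1) = m (q + 2) * A (q + 2) d + A (q + 1) d) ∧ A (q + 4) 0 = 0 := by
    refine ⟨fun d => ?_, ?_⟩
    · have := caterpillarBetti_of_eq_zero (q := q + 1) h (d + 1)
      rw [hB _ _ (by omega) (by omega), hB _ _ (by omega) (by omega),
        hB _ _ (by omega) (by omega)] at this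
      exact_mod_cast this
    · have := caterpillarBetti_of_eq_zero (q := q + 1) h 0
      rw [hB _ _ (by omega) (by omega), h0 _ (by omega), h0 _ (by omega)] at this
      simpa using this
  refine ⟨hleg (q + 2) le_rfl (by omega), fun h h1 => ?_, fun h h1 => ?_⟩
  · obtain ⟨h2, h3⟩ := hleg (q + 1) (by omega) (by omega) h1
    refine ⟨fun d => ?_, (hzero h).2.trans h3.symm⟩
    obtain ⟨t, ht⟩ : ∃ t, m (q + 2) = t + 1 := ⟨_, (Nat.sub_add_cancel h1).symm⟩
    rw [(hzero h).1, h2, ht, Nat.add_sub_cancel]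
    ring
  · refine ⟨fun d => ?_, (hzero h).2⟩
    rw [(hzero h).1, h1, zero_mul, zero_add]
end

section
/- For k ≥ 1 and elements a₁, …, a_k of a commutative ring, define L_k(a₁, …, a_k) = Σ (i₂ − i₁)(i₃ − i₂)⋯(i_ℓ − i_{ℓ−1}) · a_{i₁} a_{i₂} ⋯ a_{i_ℓ}, the sum ranging over all ℓ with 1 ≤ ℓ ≤ k and all sequences 1 ≤ i₁ < i₂ < ⋯ < i_ℓ ≤ k (with the empty product of differences equal to 1 when ℓ = 1). Then for all k ≥ 2, L_k(a₁, …, a_k) = a_k · L_{k−1}(a₁, …, a_{k−2}, a_{k−1} + 1) + L_{k−1}(a₁, …, a_{k−1}). -/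
/-- The product `(i₂−i₁)(i₃−i₂)⋯(i_ℓ−i_{ℓ−1})` of consecutive differences of the
elements `i₁ < i₂ < ⋯ < i_ℓ` of a finite set of naturals (equal to `1` for a
singleton or the empty set). -/
def consecDiffProd (s : Finset ℕ) : ℕ :=
  (((s.sort (· ≤ ·)).zip (s.sort (· ≤ ·)).tail).map fun p => p.2 - p.1).prod

/-- `L_k(a₁, …, a_k) = Σ_{ℓ=1}^{k} Σ_{1 ≤ i₁ < ⋯ < i_ℓ ≤ k}
(i₂−i₁)⋯(i_ℓ−i_{ℓ−1}) a_{i₁} ⋯ a_{i_ℓ}`. -/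
def Lsum {R : Type*} [CommRing R] (k : ℕ) (a : ℕ → R) : R :=
  ∑ s ∈ (Finset.Icc 1 k).powerset.filter (fun s => s.Nonempty),
    (consecDiffProd s : R) * ∏ i ∈ s, a i

theorem Finset.sort_insert_of_forall_lt {t : Finset ℕ} {m : ℕ} (h : ∀ i ∈ t, i < m) :
    (insert m t).sort (· ≤ ·) = t.sort (· ≤ ·) ++ [m] := by
  have hm : m ∉ t := fun hmt => (h m hmt).false
  refine List.Perm.eq_of_pairwise' (r := (· ≤ ·)) (Finset.pairwise_sort _ _) ?_ ?_
  · rw [List.pairwise_append]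
    refine ⟨Finset.pairwise_sort _ _, List.pairwise_singleton _ _, ?_⟩
    intro x hx y hy
    rw [Finset.mem_sort] at hx
    rw [List.mem_singleton] at hy
    exact hy ▸ (h x hx).le
  · rw [List.perm_ext_iff_of_nodup (Finset.sort_nodup _ _)]
    · intro x
      simp [or_comm]
    · rw [List.nodup_append]
      refine ⟨Finset.sort_nodup _ _, List.nodup_singleton _, ?_⟩
      intro x hx y hy
      rw [Finset.mem_sort] at hx
      rw [List.mem_singleton] at hy
      exact hy ▸ (h x hx).ne

theorem List.zip_tail_append_pair {α : Type*} (l : List α) (x y : α) :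
    (l ++ [x] ++ [y]).zip (l ++ [x] ++ [y]).tail =
      (l ++ [x]).zip (l ++ [x]).tail ++ [(x, y)] := by
  induction l with
  | nil => simp
  | cons b l ih =>
    cases l with
    | nil => simp
    | cons c l => simpa using ih

theorem consecDiffProd_singleton (m : ℕ) : consecDiffProd {m} = 1 := by
  simp [consecDiffProd]

theorem consecDiffProd_insert_insert {u : Finset ℕ} {M m : ℕ} (hu : ∀ i ∈ u, i < M)
    (hm : M < m) :
    consecDiffProd (insert m (insert M u)) = consecDiffProd (insert M u) * (m - M) := by
  have h : ∀ i ∈ insert M u, i < m := by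
    intro i hi
    rcases Finset.mem_insert.mp hi with rfl | hi
    · exact hm
    · exact (hu i hi).trans hm
  unfold consecDiffProd
  rw [Finset.sort_insert_of_forall_lt h, Finset.sort_insert_of_forall_lt hu,
    List.zip_tail_append_pair]
  simp

theorem consecDiffProd_insert_succ {t : Finset ℕ} (ht : t.Nonempty) {m : ℕ}
    (h : ∀ i ∈ t, i < m) :
    consecDiffProd (insert (m + 1) t) = consecDiffProd (insert m t) + consecDiffProd t := by
  have hlt : ∀ i ∈ t.erase (t.max' ht), i < t.max' ht :=
    fun i hi => t.lt_max'_of_mem_erase_max' ht hi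
  have hM := h _ (t.max'_mem ht)
  have key := consecDiffProd_insert_insert hlt hM
  have key_succ := consecDiffProd_insert_insert hlt (hM.trans m.lt_succ_self)
  rw [Finset.insert_erase (t.max'_mem ht)] at key key_succ
  rw [key, key_succ, Nat.succ_sub hM.le, Nat.succ_eq_add_one, mul_add_one]

/-- The sum over sequences `1 ≤ i₁ < ⋯ < i_ℓ ≤ n`, possibly empty, weighted by the consecutive
differences of the sequence extended by the endpoint `m`. -/
def endpointSum {R : Type*} [CommRing R] (n m : ℕ) (a : ℕ → R) : R :=
  ∑ t ∈ (Finset.Icc 1 n).powerset, (consecDiffProd (insert m t) : R) * ∏ i ∈ t, a i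

section

variable {R : Type*} [CommRing R]

theorem lt_of_mem_powerset_Icc {n m : ℕ} (h : n < m) {t : Finset ℕ}
    (ht : t ∈ (Finset.Icc 1 n).powerset) : ∀ i ∈ t, i < m := fun _ hi =>
  (Finset.mem_Icc.mp (Finset.mem_powerset.mp ht hi)).2.trans_lt h

theorem sum_powerset_Icc_succ (n : ℕ) (f : Finset ℕ → R) :
    ∑ t ∈ (Finset.Icc 1 (n + 1)).powerset, f t =
      ∑ t ∈ (Finset.Icc 1 n).powerset, f t +
        ∑ t ∈ (Finset.Icc 1 n).powerset, f (insert (n + 1) t) := by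
  rw [← Finset.insert_Icc_right_eq_Icc_add_one (by omega), Finset.sum_powerset_insert (by simp)]

theorem Lsum_succ (n : ℕ) (a : ℕ → R) :
    Lsum (n + 1) a = Lsum n a + a (n + 1) * endpointSum n (n + 1) a := by
  unfold Lsum endpointSum
  rw [Finset.sum_filter, Finset.sum_filter, sum_powerset_Icc_succ, Finset.mul_sum]
  congr 1
  refine Finset.sum_congr rfl fun t ht => ?_
  have hn : n + 1 ∉ t := fun h => (lt_of_mem_powerset_Icc n.lt_succ_self ht _ h).false
  rw [if_pos (Finset.insert_nonempty _ _), Finset.prod_insert hn]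
  ring

theorem endpointSum_succ_left (n : ℕ) (a : ℕ → R) :
    endpointSum (n + 1) (n + 2) a =
      endpointSum n (n + 2) a + a (n + 1) * endpointSum n (n + 1) a := by
  unfold endpointSum
  rw [sum_powerset_Icc_succ, Finset.mul_sum]
  congr 1
  refine Finset.sum_congr rfl fun t ht => ?_
  have hlt := lt_of_mem_powerset_Icc n.lt_succ_self ht
  have hn : n + 1 ∉ t := fun h => (hlt _ h).false
  rw [consecDiffProd_insert_insert hlt (n + 1).lt_succ_self, Finset.prod_insert hn,
    show (n + 1).succ - (n + 1) = 1 by omega, mul_one]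
  ring

theorem endpointSum_succ_right {n m : ℕ} (h : n < m) (a : ℕ → R) :
    endpointSum n (m + 1) a = endpointSum n m a + Lsum n a := by
  unfold endpointSum Lsum
  rw [Finset.sum_filter, ← Finset.sum_add_distrib]
  refine Finset.sum_congr rfl fun t ht => ?_
  rcases t.eq_empty_or_nonempty with rfl | hne
  · simp [consecDiffProd_singleton]
  · rw [if_pos hne, consecDiffProd_insert_succ hne (lt_of_mem_powerset_Icc h ht)]
    push_cast
    ring

theorem prod_congr_of_mem_powerset_Icc {n : ℕ} {a b : ℕ → R} (h : ∀ i ≤ n, a i = b i)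
    {t : Finset ℕ} (ht : t ∈ (Finset.Icc 1 n).powerset) : ∏ i ∈ t, a i = ∏ i ∈ t, b i :=
  Finset.prod_congr rfl fun i hi =>
    h i (Nat.lt_succ_iff.mp (lt_of_mem_powerset_Icc n.lt_succ_self ht i hi))

theorem Lsum_congr {n : ℕ} {a b : ℕ → R} (h : ∀ i ≤ n, a i = b i) : Lsum n a = Lsum n b :=
  Finset.sum_congr rfl fun t ht => by
    rw [prod_congr_of_mem_powerset_Icc h (Finset.mem_filter.mp ht).1]

theorem endpointSum_congr {n : ℕ} {a b : ℕ → R} (h : ∀ i ≤ n, a i = b i) (m : ℕ) :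
    endpointSum n m a = endpointSum n m b :=
  Finset.sum_congr rfl fun t ht => by rw [prod_congr_of_mem_powerset_Icc h ht]

end

/-- For `k ≥ 2`,
`L_k(a₁,…,a_k) = a_k · L_{k−1}(a₁,…,a_{k−2}, a_{k−1}+1) + L_{k−1}(a₁,…,a_{k−1})`. -/
theorem Lsum_recursion {R : Type*} [CommRing R] (k : ℕ) (hk : 2 ≤ k) (a : ℕ → R) :
    Lsum k a =
      a k * Lsum (k - 1) (fun i => if i = k - 1 then a (k - 1) + 1 else a i) +
        Lsum (k - 1) a := by
  obtain ⟨n, rfl⟩ := Nat.exists_eq_add_of_le' hk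
  rw [show n + 2 - 1 = n + 1 from rfl]
  have h : ∀ i ≤ n, (if i = n + 1 then a (n + 1) + 1 else a i) = a i :=
    fun i hi => if_neg (by omega)
  rw [Lsum_succ (n + 1) a, endpointSum_succ_left, endpointSum_succ_right n.lt_succ_self,
    Lsum_succ n (fun i => if i = n + 1 then a (n + 1) + 1 else a i), Lsum_congr h,
    endpointSum_congr h, if_pos rfl]
  ring
end
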